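/- arXiv:0711.0598 — 5 statements merged into one kernel-verified Lean document; each statement's English description precedes it below -/
import Mathlib

section
/- Let γ ≥ 2 be an integer and let F(ρ,μ) be complex valued, C^{γ+1} in ρ on [0,δ), satisfying conditions (F1)–(F4). Then, if δ > 0 is sufficiently small (depending only on γ and the constants in (F2), (F4)), there exists a constant C > 0 such that |∂_ρ F(ρ,μ)| ≥ C ρ^{γ-1} for all 0 < ρ < δ and all parameters μ. -/
/-- Norm equivalence on polynomials of degree at most `m`: the coefficient norm is controlled by
the values on `(0, 1]`. -/
theorem exists_pos_mul_sum_norm_coeff_le_norm_eval (m : ℕ) :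
    ∃ c > 0, ∀ b : ℕ → ℂ, ∃ t ∈ Set.Ioc (0 : ℝ) 1,
      c * ∑ k ∈ Finset.range (m + 1), ‖b k‖ ≤ ‖∑ k ∈ Finset.range (m + 1), t ^ k • b k‖ := by
  let x : Fin (m + 1) → ℝ := fun i => ((i : ℝ) + 1) / (m + 1)
  have hm : (0 : ℝ) < m + 1 := by positivity
  have hx : ∀ i, x i ∈ Set.Ioc (0 : ℝ) 1 := fun i => by
    refine ⟨by positivity, (div_le_one hm).2 ?_⟩
    have : ((i : ℕ) : ℝ) ≤ m := by exact_mod_cast Nat.lt_succ_iff.1 i.2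
    linarith
  have hinj : Function.Injective (fun i => (x i : ℂ)) := fun i j h => by
    have h' : x i = x j := Complex.ofReal_injective h
    have h'' : ((i : ℕ) : ℝ) + 1 = (j : ℕ) + 1 := (div_left_inj' hm.ne').1 h'
    exact Fin.ext (by exact_mod_cast add_right_cancel h'')
  let V := Matrix.vandermonde (fun i => (x i : ℂ))
  have hV : Function.Injective V.mulVec :=
    Matrix.mulVec_injective_of_isUnit
      ((Matrix.isUnit_iff_isUnit_det _).2 (Matrix.det_vandermonde_ne_zero_iff.2 hinj).isUnit)
  obtain ⟨K, hK, hanti⟩ := V.mulVecLin.exists_antilipschitzWith (LinearMap.ker_eq_bot.2 hV)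
  refine ⟨((m + 1) * K)⁻¹, by positivity, fun b => ?_⟩
  let v : Fin (m + 1) → ℂ := fun i => b i
  obtain ⟨i, hi⟩ := Finite.exists_max fun i => ‖V.mulVec v i‖
  refine ⟨x i, hx i, ?_⟩
  have hval : V.mulVec v i = ∑ k ∈ Finset.range (m + 1), x i ^ k • b k := by
    rw [Finset.sum_range]
    simp [V, v, Matrix.mulVec, dotProduct, Matrix.vandermonde_apply]
  have hle : ‖v‖ ≤ K * ‖V.mulVec v i‖ := by
    have h := hanti.le_mul_dist v 0
    rw [map_zero, dist_zero_right, dist_zero_right] at h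
    refine h.trans (mul_le_mul_of_nonneg_left ?_ K.2)
    exact (pi_norm_le_iff_of_nonneg (norm_nonneg _)).2 hi
  have hsum : ∑ k ∈ Finset.range (m + 1), ‖b k‖ ≤ (m + 1) * ‖v‖ := by
    rw [Finset.sum_range]
    calc ∑ k : Fin (m + 1), ‖b k‖ ≤ ∑ _k : Fin (m + 1), ‖v‖ :=
          Finset.sum_le_sum fun k _ => norm_le_pi_norm v k
      _ = (m + 1) * ‖v‖ := by simp
  have hK' : (0 : ℝ) < K := hK
  rw [← hval, inv_mul_le_iff₀ (by positivity), mul_assoc]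
  exact hsum.trans (mul_le_mul_of_nonneg_left hle hm.le)

/-- Taylor's formula at the left endpoint of `[0, δ)`, with a derivative bound assumed only on
the open interval. -/
theorem norm_sub_taylor_Ico_le {G : ℝ → ℂ} {δ K : ℝ} {m : ℕ} (hδ : 0 < δ)
    (hG : ContDiffOn ℝ (m + 1) G (Set.Ico 0 δ))
    (hK : ∀ y ∈ Set.Ioo 0 δ, ‖iteratedDerivWithin (m + 1) G (Set.Ico 0 δ) y‖ ≤ K)
    {x : ℝ} (hx : x ∈ Set.Ioo 0 δ) :
    ‖G x - ∑ k ∈ Finset.range (m + 1),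
        x ^ k • ((k.factorial : ℝ)⁻¹ • iteratedDerivWithin k G (Set.Ico 0 δ) 0)‖
      ≤ K * x ^ (m + 1) := by
  have hsub : Set.Icc 0 x ⊆ Set.Ico 0 δ := fun y hy => ⟨hy.1, hy.2.trans_lt hx.2⟩
  have hder : ∀ k ≤ m + 1, ∀ y ∈ Set.Icc 0 x,
      iteratedDerivWithin k G (Set.Icc 0 x) y = iteratedDerivWithin k G (Set.Ico 0 δ) y := by
    intro k hk y hy
    rw [iteratedDerivWithin, iteratedDerivWithin,
      iteratedFDerivWithin_subset hsub (uniqueDiffOn_Icc hx.1) (uniqueDiffOn_Ico 0 δ)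
        (hG.of_le (by exact_mod_cast hk)) hy]
  have hcont : ContinuousOn (iteratedDerivWithin (m + 1) G (Set.Ico 0 δ)) (Set.Ico 0 δ) :=
    hG.continuousOn_iteratedDerivWithin (by norm_cast) (uniqueDiffOn_Ico 0 δ)
  have hbound : ∀ y ∈ Set.Ico 0 δ, ‖iteratedDerivWithin (m + 1) G (Set.Ico 0 δ) y‖ ≤ K := by
    intro y hy
    have hmem : y ∈ closure (Set.Ioo 0 δ) := by
      rw [closure_Ioo hδ.ne]
      exact ⟨hy.1, hy.2.le⟩
    exact ((hcont y hy).mono Set.Ioo_subset_Ico_self).norm.closure_le hmem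
      continuousWithinAt_const hK
  have h := taylor_mean_remainder_bound hx.1.le (hG.mono hsub) (Set.right_mem_Icc.2 hx.1.le)
    (C := K) fun y hy => by rw [hder _ le_rfl y hy]; exact hbound y (hsub hy)
  have hK0 : 0 ≤ K := (norm_nonneg _).trans (hK x hx)
  rw [taylor_within_apply, sub_zero] at h
  have hsum : ∑ k ∈ Finset.range (m + 1),
        x ^ k • ((k.factorial : ℝ)⁻¹ • iteratedDerivWithin k G (Set.Ico 0 δ) 0)
      = ∑ k ∈ Finset.range (m + 1),
        ((k.factorial : ℝ)⁻¹ * x ^ k) • iteratedDerivWithin k G (Set.Icc 0 x) 0 := by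
    refine Finset.sum_congr rfl fun k hk => ?_
    rw [hder k (Finset.mem_range.1 hk).le 0 (Set.left_mem_Icc.2 hx.1.le), smul_smul, mul_comm]
  rw [hsum]
  have hx0 := hx.1
  exact h.trans (div_le_self (by positivity) (by exact_mod_cast m.factorial_pos))


/-- Let `γ ≥ 2` and let `F(ρ,μ)` be complex valued, `C^{γ+1}`
in `ρ` on `[0,δ)`, satisfying (F1)–(F4) (with Taylor coefficients
`a_j(μ) = ∂_ρ^j F(0,μ)/j!`). Then, for `δ > 0` sufficiently small (depending
only on `γ` and the constants `C₀` of (F2) and `M_k` of (F4)), there is a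
constant `C > 0` with `|∂_ρ F(ρ,μ)| ≥ C ρ^{γ-1}` for all `0 < ρ < δ`, `μ`. -/
theorem stmt_1 (γ : ℕ) (hγ : 2 ≤ γ) (P : Type*) [Nonempty P]
    (C₀ : ℝ) (hC₀ : 0 < C₀) (M : ℕ → ℝ) :
    ∃ δ₀ > 0, ∀ δ : ℝ, 0 < δ → δ ≤ δ₀ →
      ∀ F : P → ℝ → ℂ,
        -- `F(·,μ)` is `C^{γ+1}` on `[0,δ)`
        (∀ μ, ContDiffOn ℝ ((γ + 1 : ℕ) : ℕ∞) (F μ) (Set.Ico 0 δ)) →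
        -- (F1): `a₀(μ) = a₁(μ) = 0`
        (∀ μ, iteratedDerivWithin 0 (F μ) (Set.Ico 0 δ) 0 = 0 ∧
              iteratedDerivWithin 1 (F μ) (Set.Ico 0 δ) 0 = 0) →
        -- (F2): `∑_{j=2}^γ |a_j(μ)| ≥ C₀`
        (∀ μ, C₀ ≤ ∑ j ∈ Finset.Icc 2 γ,
              ‖iteratedDerivWithin j (F μ) (Set.Ico 0 δ) 0 / (j.factorial : ℂ)‖) →
        -- (F3): `|∂_ρ F(ρ,μ)|` is increasing in `ρ` on `(0,δ)`
        (∀ μ, MonotoneOn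
              (fun ρ => ‖iteratedDerivWithin 1 (F μ) (Set.Ico 0 δ) ρ‖)
              (Set.Ioo 0 δ)) →
        -- (F4): `|∂_ρ^k F(ρ,μ)| ≤ M_k` on `(0,δ)` for `k ≤ γ+1`
        (∀ k : ℕ, k ≤ γ + 1 → ∀ μ, ∀ ρ ∈ Set.Ioo (0:ℝ) δ,
              ‖iteratedDerivWithin k (F μ) (Set.Ico 0 δ) ρ‖ ≤ M k) →
        ∃ C > 0, ∀ μ, ∀ ρ ∈ Set.Ioo (0:ℝ) δ,
          C * ρ ^ (γ - 1) ≤ ‖iteratedDerivWithin 1 (F μ) (Set.Ico 0 δ) ρ‖ := by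
  obtain ⟨m, rfl⟩ : ∃ m, γ = m + 1 := ⟨γ - 1, by omega⟩
  obtain ⟨c, hc, hpoly⟩ := exists_pos_mul_sum_norm_coeff_le_norm_eval m
  set K := |M (m + 2)|
  have hK0 : 0 ≤ K := abs_nonneg _
  refine ⟨min 1 (c * C₀ / (2 * (K + 1))), by positivity, ?_⟩
  intro δ hδ hδ₀ F hF _ hF2 hF3 hF4
  have hδ1 : δ ≤ 1 := hδ₀.trans (min_le_left _ _)
  have hδ2 : δ * (2 * (K + 1)) ≤ c * C₀ :=
    (le_div_iff₀ (by positivity)).1 (hδ₀.trans (min_le_right _ _))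
  refine ⟨c * C₀ / 2, by positivity, fun μ ρ hρ => ?_⟩
  have hρ0 := hρ.1
  have hρ1 : ρ ≤ 1 := hρ.2.le.trans hδ1
  rw [Nat.add_sub_cancel]
  set S := Set.Ico (0 : ℝ) δ
  let G := derivWithin (F μ) S
  have hGk : ∀ k, iteratedDerivWithin (k + 1) (F μ) S = iteratedDerivWithin k G S := fun k => by
    ext y
    rw [iteratedDerivWithin_succ']
  have hG : ContDiffOn ℝ (m + 1) G S :=
    (hF μ).derivWithin (uniqueDiffOn_Ico 0 δ) (by norm_cast)
  let b : ℕ → ℂ := fun k => (k.factorial : ℝ)⁻¹ • iteratedDerivWithin k G S 0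
  have htaylor : ∀ x ∈ Set.Ioo 0 δ,
      ‖G x - ∑ k ∈ Finset.range (m + 1), x ^ k • b k‖ ≤ K * x ^ (m + 1) := fun x hx =>
    norm_sub_taylor_Ico_le hδ hG (fun y hy => by
      rw [← hGk]
      exact (hF4 (m + 2) le_rfl μ y hy).trans (le_abs_self _)) hx
  have hcoeff : C₀ ≤ ∑ k ∈ Finset.range (m + 1), ‖b k‖ := by
    refine (hF2 μ).trans ?_
    have himage : Finset.Icc 2 (m + 1) ⊆ (Finset.range (m + 1)).image (· + 1) := fun j hj => by
      rw [Finset.mem_Icc] at hj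
      exact Finset.mem_image.2 ⟨j - 1, Finset.mem_range.2 (by omega), by omega⟩
    refine (Finset.sum_le_sum_of_subset_of_nonneg himage fun _ _ _ => norm_nonneg _).trans ?_
    rw [Finset.sum_image fun _ _ _ _ h => Nat.succ_injective h]
    refine Finset.sum_le_sum fun k _ => ?_
    have hfac : (k.factorial : ℝ) ≤ (k + 1).factorial := by
      exact_mod_cast Nat.factorial_le k.le_succ
    have hpos : (0 : ℝ) < k.factorial := by exact_mod_cast k.factorial_pos
    simp only [b, hGk, norm_div, norm_smul, norm_inv, Complex.norm_natCast, Real.norm_natCast]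
    rw [div_eq_inv_mul]
    gcongr
  obtain ⟨t, ht, hval⟩ := hpoly fun k => ρ ^ k • b k
  have hs : t * ρ ∈ Set.Ioo 0 δ :=
    ⟨mul_pos ht.1 hρ0, (mul_le_of_le_one_left hρ0.le ht.2).trans_lt hρ.2⟩
  have hsρ : t * ρ ≤ ρ := mul_le_of_le_one_left hρ0.le ht.2
  have hmono : ‖G (t * ρ)‖ ≤ ‖G ρ‖ := by
    simpa only [iteratedDerivWithin_one] using hF3 μ hs hρ hsρ
  have hlower : c * (C₀ * ρ ^ m) ≤ ‖∑ k ∈ Finset.range (m + 1), (t * ρ) ^ k • b k‖ := by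
    have hsum : ∑ k ∈ Finset.range (m + 1), (t * ρ) ^ k • b k
        = ∑ k ∈ Finset.range (m + 1), t ^ k • ρ ^ k • b k :=
      Finset.sum_congr rfl fun k _ => by rw [mul_pow, mul_smul]
    rw [hsum]
    refine le_trans (mul_le_mul_of_nonneg_left ?_ hc.le) hval
    calc C₀ * ρ ^ m ≤ (∑ k ∈ Finset.range (m + 1), ‖b k‖) * ρ ^ m := by gcongr
      _ = ∑ k ∈ Finset.range (m + 1), ‖b k‖ * ρ ^ m := Finset.sum_mul _ _ _
      _ ≤ ∑ k ∈ Finset.range (m + 1), ‖ρ ^ k • b k‖ := by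
        refine Finset.sum_le_sum fun k hk => ?_
        rw [norm_smul (ρ ^ k), norm_pow, Real.norm_of_nonneg hρ0.le, mul_comm ‖b k‖]
        exact mul_le_mul_of_nonneg_right
          (pow_le_pow_of_le_one hρ0.le hρ1 (Nat.lt_succ_iff.1 (Finset.mem_range.1 hk)))
          (norm_nonneg _)
  have hrem : K * (t * ρ) ^ (m + 1) ≤ c * C₀ / 2 * ρ ^ m := by
    have hKδ : K * ρ ≤ c * C₀ / 2 := by nlinarith [mul_le_mul_of_nonneg_left hρ.2.le hK0]
    calc K * (t * ρ) ^ (m + 1) ≤ K * ρ ^ (m + 1) := by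
          gcongr
          exact hs.1.le
      _ = K * ρ * ρ ^ m := by ring
      _ ≤ c * C₀ / 2 * ρ ^ m := by gcongr
  have htri := norm_sub_norm_le (∑ k ∈ Finset.range (m + 1), (t * ρ) ^ k • b k) (G (t * ρ))
  rw [norm_sub_rev] at htri
  rw [iteratedDerivWithin_one]
  linarith [htaylor _ hs]
end

section
/- Let γ ≥ 2 be an integer and let F(ρ,μ) be complex valued, C^{γ+1} in ρ on [0,δ), satisfying conditions (F1)–(F4). Then, if δ > 0 is sufficiently small (depending only on γ and the constants in (F2), (F4)), for every integer m with 1 ≤ m ≤ γ+1 there exists a constant C_m > 0 such that |∂_ρ^m F(ρ,μ)| ≤ C_m ρ^{1-m} |∂_ρ F(ρ,μ)| for all 0 < ρ < δ and all parameters μ. -/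
open Set Finset in
/-- Taylor estimate at `0` along a chain of successive derivatives on `[0, δ)`. -/
lemma norm_sub_taylor_le {δ M : ℝ} (n : ℕ) : ∀ g : ℕ → ℝ → ℂ,
    (∀ k < n, ∀ x ∈ Ico 0 δ, HasDerivWithinAt (g k) (g (k + 1) x) (Ico 0 δ) x) →
    (∀ x ∈ Ico 0 δ, ‖g n x‖ ≤ M) → ∀ x ∈ Ico 0 δ,
    ‖g 0 x - ∑ j ∈ range n, g j 0 * ((x : ℂ) ^ j / (j.factorial : ℂ))‖ ≤ M * x ^ n := by
  induction n with
  | zero => intro g _ hM x hx; simpa using hM x hx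
  | succ n ih =>
    intro g hg hM x hx
    have hM0 : 0 ≤ M := (norm_nonneg _).trans (hM x hx)
    have ih' := ih (fun k => g (k + 1)) (fun k hk => hg (k + 1) (by omega)) hM
    have hpoly (y : ℝ) : HasDerivAt
        (fun y : ℝ => ∑ j ∈ range (n + 1), g j 0 * ((y : ℂ) ^ j / (j.factorial : ℂ)))
        (∑ j ∈ range n, g (j + 1) 0 * ((y : ℂ) ^ j / (j.factorial : ℂ))) y := by
      have h : HasDerivAt
          (fun y : ℝ => ∑ j ∈ range (n + 1), g j 0 * ((y : ℂ) ^ j / (j.factorial : ℂ)))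
          (∑ j ∈ range (n + 1), g j 0 * ((j * (y : ℂ) ^ (j - 1)) / (j.factorial : ℂ))) y := by
        refine HasDerivAt.fun_sum fun j _ => ?_
        exact ((hasDerivAt_pow j (y : ℂ)).comp_ofReal.div_const _).const_mul _
      convert h using 1
      rw [sum_range_succ']
      simp only [Nat.cast_zero, zero_mul, zero_div, mul_zero, add_zero]
      refine sum_congr rfl fun j _ => ?_
      have : ((j : ℂ) + 1) ≠ 0 := by exact_mod_cast Nat.succ_ne_zero j
      rw [Nat.factorial_succ, Nat.add_sub_cancel]
      push_cast
      rw [mul_div_mul_left _ _ this]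
    have hsub : Icc 0 x ⊆ Ico 0 δ := fun y hy => ⟨hy.1, hy.2.trans_lt hx.2⟩
    have key := (convex_Icc (0 : ℝ) x).norm_image_sub_le_of_norm_hasDerivWithin_le
      (C := M * x ^ n)
      (fun y hy => ((hg 0 (Nat.succ_pos n) y (hsub hy)).mono hsub).sub
        (hpoly y).hasDerivWithinAt)
      (fun y hy => (ih' y (hsub hy)).trans
        (mul_le_mul_of_nonneg_left (pow_le_pow_left₀ hy.1 hy.2 n) hM0))
      (left_mem_Icc.2 hx.1) (right_mem_Icc.2 hx.1)
    have h0 : ∑ j ∈ range (n + 1), g j 0 * (((0 : ℝ) : ℂ) ^ j / (j.factorial : ℂ)) = g 0 0 := by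
      rw [sum_range_succ']
      simp
    simp only [Pi.sub_apply] at key
    rwa [h0, sub_self, sub_zero, sub_zero, Real.norm_of_nonneg hx.1, mul_assoc,
      ← pow_succ] at key

open Set Finset in
/-- The coefficients of a polynomial are controlled by its supremum on `(0, 1]`. -/
lemma exists_coeff_le_of_norm_le (n : ℕ) : ∃ K > 0, ∀ (b : ℕ → ℂ) (X : ℝ),
    (∀ t ∈ Ioc (0 : ℝ) 1, ‖∑ j ∈ range n, b j * (t : ℂ) ^ j‖ ≤ X) →
    ∀ j < n, ‖b j‖ ≤ K * X := by
  let t : Fin n → ℝ := fun i => ((i : ℝ) + 1) / n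
  have ht (i : Fin n) : t i ∈ Ioc (0 : ℝ) 1 := by
    have hn : (0 : ℝ) < n := by exact_mod_cast i.pos
    refine ⟨by positivity, (div_le_one hn).2 ?_⟩
    exact_mod_cast i.isLt
  have hinj : Function.Injective fun i => (t i : ℂ) := by
    intro i k h
    have hn : (n : ℝ) ≠ 0 := by exact_mod_cast i.pos.ne'
    have h' : t i = t k := Complex.ofReal_injective h
    have h'' : (i : ℝ) + 1 = k + 1 := (div_left_inj' hn).1 h'
    exact Fin.ext (by exact_mod_cast add_right_cancel h'')
  let A : Matrix (Fin n) (Fin n) ℂ := Matrix.vandermonde fun i => (t i : ℂ)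
  have hA : Function.Injective A.mulVec :=
    Matrix.mulVec_injective_of_isUnit
      ((Matrix.isUnit_iff_isUnit_det _).2 (Matrix.det_vandermonde_ne_zero_iff.2 hinj).isUnit)
  obtain ⟨K, hK, hKA⟩ := A.mulVecLin.exists_antilipschitzWith (LinearMap.ker_eq_bot.2 hA)
  refine ⟨K, hK, fun b X hX j hj => ?_⟩
  have hX0 : 0 ≤ X := (norm_nonneg _).trans (hX _ (ht ⟨j, hj⟩))
  have h := hKA.le_mul_dist (fun i : Fin n => b i) 0
  rw [map_zero, dist_zero_right, dist_zero_right] at h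
  refine (norm_le_pi_norm (fun i : Fin n => b i) ⟨j, hj⟩).trans (h.trans ?_)
  refine mul_le_mul_of_nonneg_left ((pi_norm_le_iff_of_nonneg hX0).2 fun i => ?_) K.2
  have := hX _ (ht i)
  rw [← Fin.sum_univ_eq_sum_range (fun j => b j * (t i : ℂ) ^ j)] at this
  simpa [A, Matrix.mulVec, dotProduct, Matrix.vandermonde_apply, mul_comm] using this

open Set Finset in
/-- If `|h₀|` is increasing and the Taylor coefficients of `h₀` at `0` are bounded below in total,
then each derivative satisfies `ρ ^ k |h_k| ≤ C |h₀|` near `0`, uniformly. -/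
lemma exists_pow_mul_norm_deriv_le (n : ℕ) {C₀ M : ℝ} (hC₀ : 0 < C₀) (hM : 0 ≤ M) :
    ∃ δ₀ > (0 : ℝ), ∃ C > (0 : ℝ), ∀ δ ≤ δ₀, ∀ h : ℕ → ℝ → ℂ,
      (∀ k < n, ∀ x ∈ Ico 0 δ, HasDerivWithinAt (h k) (h (k + 1) x) (Ico 0 δ) x) →
      (∀ x ∈ Ico 0 δ, ‖h n x‖ ≤ M) →
      C₀ ≤ ∑ j ∈ range n, ‖h j 0‖ →
      MonotoneOn (fun x => ‖h 0 x‖) (Ioo 0 δ) →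
      ∀ k ≤ n, ∀ ρ ∈ Ioo 0 δ, ρ ^ k * ‖h k ρ‖ ≤ C * ‖h 0 ρ‖ := by
  obtain ⟨K, hK, hcoeff⟩ := exists_coeff_le_of_norm_le n
  set L : ℝ := (n + 1) * (n.factorial * K) with hL
  have hLpos : 0 < L := by positivity
  refine ⟨min 1 (C₀ / (2 * L * M + 1)), by positivity, (1 + M / C₀) * (2 * L), by positivity, ?_⟩
  intro δ hδ h hder hbd hlow hmono k hk ρ hρ
  have hρ0 : 0 < ρ := hρ.1
  have hρ1 : ρ ≤ 1 := hρ.2.le.trans (hδ.trans (min_le_left _ _))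
  have hρ2 : ρ * (2 * L * M + 1) ≤ C₀ :=
    (le_div_iff₀ (by positivity)).1 (hρ.2.le.trans (hδ.trans (min_le_right _ _)))
  set S : ℝ := ∑ j ∈ range n, ‖h j 0‖ * ρ ^ j with hS
  have hS0 : 0 ≤ S := by positivity
  have hrem : C₀ * ρ ^ n ≤ ρ * S := by
    calc C₀ * ρ ^ n ≤ (∑ j ∈ range n, ‖h j 0‖) * ρ ^ n := by gcongr
      _ = ∑ j ∈ range n, ‖h j 0‖ * ρ ^ n := sum_mul _ _ _
      _ ≤ ∑ j ∈ range n, ‖h j 0‖ * ρ ^ (j + 1) := by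
        refine sum_le_sum fun j hj => mul_le_mul_of_nonneg_left ?_ (norm_nonneg _)
        exact pow_le_pow_of_le_one hρ0.le hρ1 (mem_range.1 hj)
      _ = ρ * S := by
        rw [hS, mul_sum]
        exact sum_congr rfl fun j _ => by ring
  have hsup : ∀ t ∈ Ioc (0 : ℝ) 1,
      ‖∑ j ∈ range n, (h j 0 * (ρ : ℂ) ^ j / (j.factorial : ℂ)) * (t : ℂ) ^ j‖
        ≤ ‖h 0 ρ‖ + M * ρ ^ n := by
    intro t ht
    have hle : t * ρ ≤ ρ := mul_le_of_le_one_left hρ0.le ht.2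
    have htρ : t * ρ ∈ Ioo 0 δ := ⟨mul_pos ht.1 hρ0, hle.trans_lt hρ.2⟩
    have h1 := norm_sub_taylor_le n h hder hbd _ (Ioo_subset_Ico_self htρ)
    have h2 : ‖h 0 (t * ρ)‖ ≤ ‖h 0 ρ‖ := hmono htρ hρ hle
    have h3 : M * (t * ρ) ^ n ≤ M * ρ ^ n :=
      mul_le_mul_of_nonneg_left (pow_le_pow_left₀ htρ.1.le hle n) hM
    have heq : ∑ j ∈ range n, (h j 0 * (ρ : ℂ) ^ j / (j.factorial : ℂ)) * (t : ℂ) ^ j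
        = ∑ j ∈ range n, h j 0 * (((t * ρ : ℝ) : ℂ) ^ j / (j.factorial : ℂ)) := by
      refine sum_congr rfl fun j _ => ?_
      push_cast
      ring
    rw [heq]
    have h4 := norm_sub_norm_le
      (∑ j ∈ range n, h j 0 * (((t * ρ : ℝ) : ℂ) ^ j / (j.factorial : ℂ))) (h 0 (t * ρ))
    rw [norm_sub_rev] at h4
    linarith
  have hterm : ∀ j ∈ range n,
      ‖h j 0‖ * ρ ^ j ≤ n.factorial * K * (‖h 0 ρ‖ + M * ρ ^ n) := by
    intro j hj
    have h1 := hcoeff _ _ hsup j (mem_range.1 hj)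
    rw [norm_div, norm_mul, norm_pow, Complex.norm_real, Real.norm_of_nonneg hρ0.le,
      Complex.norm_natCast, div_le_iff₀ (by positivity)] at h1
    refine h1.trans ?_
    have h2 : (j.factorial : ℝ) ≤ n.factorial := by
      exact_mod_cast Nat.factorial_le (mem_range.1 hj).le
    have h3 : 0 ≤ K * (‖h 0 ρ‖ + M * ρ ^ n) := by positivity
    nlinarith
  have hSle : S ≤ L * (‖h 0 ρ‖ + M * ρ ^ n) := by
    have h1 := sum_le_card_nsmul _ _ _ hterm
    rw [card_range, nsmul_eq_mul] at h1
    have h2 : 0 ≤ n.factorial * K * (‖h 0 ρ‖ + M * ρ ^ n) := by positivity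
    rw [hL]
    linarith
  have hS2 : S ≤ 2 * L * ‖h 0 ρ‖ := by
    have h1 : C₀ * (2 * L * M * ρ ^ n) ≤ C₀ * S := by
      calc C₀ * (2 * L * M * ρ ^ n) = 2 * L * M * (C₀ * ρ ^ n) := by ring
        _ ≤ 2 * L * M * (ρ * S) := by gcongr
        _ ≤ (ρ * (2 * L * M + 1)) * S := by nlinarith [mul_nonneg hρ0.le hS0]
        _ ≤ C₀ * S := by gcongr
    have h2 := le_of_mul_le_mul_left h1 hC₀
    linarith
  have hMS : M * ρ ^ n ≤ M / C₀ * S := by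
    rw [div_mul_eq_mul_div, le_div_iff₀ hC₀, mul_assoc]
    refine mul_le_mul_of_nonneg_left ?_ hM
    nlinarith
  have hT := norm_sub_taylor_le (n - k) (fun i => h (k + i))
    (fun i hi => hder (k + i) (by omega))
    (by simpa [Nat.add_sub_cancel' hk] using hbd) ρ (Ioo_subset_Ico_self hρ)
  have hsum : ρ ^ k * ‖∑ j ∈ range (n - k), h (k + j) 0 * ((ρ : ℂ) ^ j / (j.factorial : ℂ))‖
      ≤ S := by
    calc _ ≤ ρ ^ k * ∑ j ∈ range (n - k), ‖h (k + j) 0‖ * ρ ^ j := by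
          gcongr
          refine (norm_sum_le _ _).trans (sum_le_sum fun j _ => ?_)
          rw [norm_mul, norm_div, norm_pow, Complex.norm_real, Real.norm_of_nonneg hρ0.le,
            Complex.norm_natCast]
          gcongr
          exact div_le_self (by positivity) (by exact_mod_cast Nat.factorial_pos j)
      _ = ∑ j ∈ range (n - k), ‖h (k + j) 0‖ * ρ ^ (k + j) := by
          rw [mul_sum]
          exact sum_congr rfl fun j _ => by ring
      _ ≤ S := by
          rw [hS, ← Nat.add_sub_cancel' hk, sum_range_add, Nat.add_sub_cancel_left]
          exact le_add_of_nonneg_left (by positivity)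
  have hnorm : ‖h k ρ‖ ≤ M * ρ ^ (n - k)
      + ‖∑ j ∈ range (n - k), h (k + j) 0 * ((ρ : ℂ) ^ j / (j.factorial : ℂ))‖ := by
    have := norm_sub_norm_le (h k ρ)
      (∑ j ∈ range (n - k), h (k + j) 0 * ((ρ : ℂ) ^ j / (j.factorial : ℂ)))
    simp only [add_zero] at hT
    linarith
  calc ρ ^ k * ‖h k ρ‖ ≤ ρ ^ k * (M * ρ ^ (n - k)
      + ‖∑ j ∈ range (n - k), h (k + j) 0 * ((ρ : ℂ) ^ j / (j.factorial : ℂ))‖) := by gcongr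
    _ ≤ M * ρ ^ n + S := by
      rw [mul_add]
      refine add_le_add (le_of_eq ?_) hsum
      rw [mul_left_comm, ← pow_add, Nat.add_sub_cancel' hk]
    _ ≤ (1 + M / C₀) * S := by linarith
    _ ≤ (1 + M / C₀) * (2 * L * ‖h 0 ρ‖) := by gcongr
    _ = (1 + M / C₀) * (2 * L) * ‖h 0 ρ‖ := by ring

/-- Let `γ ≥ 2` and let `F(ρ,μ)` be complex valued, `C^{γ+1}`
in `ρ` on `[0,δ)`, satisfying (F1)–(F4). Then, for `δ > 0` sufficiently small
(depending only on `γ` and the constants `C₀` of (F2) and `M_k` of (F4)), for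
every `1 ≤ m ≤ γ+1` there is `C_m > 0` with
`|∂_ρ^m F(ρ,μ)| ≤ C_m ρ^{1-m} |∂_ρ F(ρ,μ)|` for all `0 < ρ < δ` and `μ`. -/
theorem stmt_2 (γ : ℕ) (hγ : 2 ≤ γ) (P : Type*) [Nonempty P]
    (C₀ : ℝ) (hC₀ : 0 < C₀) (M : ℕ → ℝ) :
    ∃ δ₀ > 0, ∀ δ : ℝ, 0 < δ → δ ≤ δ₀ →
      ∀ F : P → ℝ → ℂ,
        -- `F(·,μ)` is `C^{γ+1}` on `[0,δ)`
        (∀ μ, ContDiffOn ℝ ((γ + 1 : ℕ) : ℕ∞) (F μ) (Set.Ico 0 δ)) →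
        -- (F1): `a₀(μ) = a₁(μ) = 0`
        (∀ μ, iteratedDerivWithin 0 (F μ) (Set.Ico 0 δ) 0 = 0 ∧
              iteratedDerivWithin 1 (F μ) (Set.Ico 0 δ) 0 = 0) →
        -- (F2): `∑_{j=2}^γ |a_j(μ)| ≥ C₀`
        (∀ μ, C₀ ≤ ∑ j ∈ Finset.Icc 2 γ,
              ‖iteratedDerivWithin j (F μ) (Set.Ico 0 δ) 0 / (j.factorial : ℂ)‖) →
        -- (F3): `|∂_ρ F(ρ,μ)|` is increasing in `ρ` on `(0,δ)`
        (∀ μ, MonotoneOn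
              (fun ρ => ‖iteratedDerivWithin 1 (F μ) (Set.Ico 0 δ) ρ‖)
              (Set.Ioo 0 δ)) →
        -- (F4): `|∂_ρ^k F(ρ,μ)| ≤ M_k` on `(0,δ)` for `k ≤ γ+1`
        (∀ k : ℕ, k ≤ γ + 1 → ∀ μ, ∀ ρ ∈ Set.Ioo (0:ℝ) δ,
              ‖iteratedDerivWithin k (F μ) (Set.Ico 0 δ) ρ‖ ≤ M k) →
        ∀ m : ℕ, 1 ≤ m → m ≤ γ + 1 →
          ∃ C > 0, ∀ μ, ∀ ρ ∈ Set.Ioo (0:ℝ) δ,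
            ‖iteratedDerivWithin m (F μ) (Set.Ico 0 δ) ρ‖ ≤
              C * ρ ^ (1 - (m : ℤ)) *
                ‖iteratedDerivWithin 1 (F μ) (Set.Ico 0 δ) ρ‖ := by
  obtain ⟨δ₀, hδ₀, C, hC, key⟩ := exists_pow_mul_norm_deriv_le γ hC₀ (abs_nonneg (M (γ + 1)))
  refine ⟨δ₀, hδ₀, fun δ hδ hδle F hF _ hF2 hF3 hF4 m hm hmγ => ⟨C, hC, fun μ ρ hρ => ?_⟩⟩
  have hud : UniqueDiffOn ℝ (Set.Ico 0 δ) := uniqueDiffOn_Ico 0 δ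
  have hbd : ∀ x ∈ Set.Ico 0 δ,
      ‖iteratedDerivWithin (γ + 1) (F μ) (Set.Ico 0 δ) x‖ ≤ |M (γ + 1)| := by
    have hcont : ContinuousOn (iteratedDerivWithin (γ + 1) (F μ) (Set.Ico 0 δ)) (Set.Ico 0 δ) :=
      (hF μ).continuousOn_iteratedDerivWithin le_rfl hud
    intro x hx
    have hcl : x ∈ closure (Set.Ioo 0 δ) := by
      rw [closure_Ioo hδ.ne]
      exact Set.Ico_subset_Icc_self hx
    have : (nhdsWithin x (Set.Ioo 0 δ)).NeBot := mem_closure_iff_nhdsWithin_neBot.1 hcl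
    refine le_of_tendsto ((hcont x hx).mono Set.Ioo_subset_Ico_self).norm ?_
    filter_upwards [self_mem_nhdsWithin] with y hy
    exact (hF4 (γ + 1) le_rfl μ y hy).trans (le_abs_self _)
  have hlow : C₀ ≤ ∑ j ∈ Finset.range γ,
      ‖iteratedDerivWithin (j + 1) (F μ) (Set.Ico 0 δ) 0‖ := by
    refine (hF2 μ).trans ?_
    rw [← Finset.sum_image (s := Finset.range γ) (g := fun j => j + 1)
      (f := fun j => ‖iteratedDerivWithin j (F μ) (Set.Ico 0 δ) 0‖) (by intro; simp)]
    refine (Finset.sum_le_sum fun j _ => ?_).trans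
      (Finset.sum_le_sum_of_subset_of_nonneg ?_ fun _ _ _ => norm_nonneg _)
    · rw [norm_div, Complex.norm_natCast]
      exact div_le_self (norm_nonneg _) (by exact_mod_cast Nat.factorial_pos j)
    · intro j hj
      rw [Finset.mem_Icc] at hj
      exact Finset.mem_image.2 ⟨j - 1, Finset.mem_range.2 (by omega), by omega⟩
  have hder : ∀ k < γ, ∀ x ∈ Set.Ico 0 δ,
      HasDerivWithinAt (iteratedDerivWithin (k + 1) (F μ) (Set.Ico 0 δ))
        (iteratedDerivWithin (k + 1 + 1) (F μ) (Set.Ico 0 δ) x) (Set.Ico 0 δ) x := by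
    intro k hk x hx
    rw [iteratedDerivWithin_succ (n := k + 1)]
    refine ((hF μ).differentiableOn_iteratedDerivWithin ?_ hud x hx).hasDerivWithinAt
    exact_mod_cast Nat.succ_lt_succ hk
  obtain ⟨k, rfl⟩ : ∃ k, m = k + 1 := ⟨m - 1, by omega⟩
  have h := key δ hδle (fun j => iteratedDerivWithin (j + 1) (F μ) (Set.Ico 0 δ))
    hder hbd hlow (hF3 μ) k (by omega) ρ hρ
  have hpow : ρ ^ (1 - ((k + 1 : ℕ) : ℤ)) = (ρ ^ k)⁻¹ := by
    rw [show 1 - ((k + 1 : ℕ) : ℤ) = -(k : ℤ) by push_cast; ring, zpow_neg, zpow_natCast]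
  have hρk : 0 < ρ ^ k := pow_pos hρ.1 k
  rw [hpow, mul_right_comm, ← div_eq_mul_inv, le_div_iff₀ hρk, mul_comm]
  exact h
end

section
/- Let γ ≥ 2 be an integer and let F(ρ,μ) be complex valued, C^{γ+1} in ρ on [0,δ), satisfying conditions (F1)–(F4), and define π(ρ,μ) := Σ_{j=2}^γ j |a_j(μ)| ρ^{j-1}. Then, if δ > 0 is sufficiently small (depending only on γ and the constants in (F2), (F4)), there exists a constant C > 0 such that |∂_ρ F(ρ,μ)| ≥ C π(ρ,μ) for all 0 < ρ < δ and all parameters μ. -/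
open Finset in
/-- On polynomials of degree less than `n`, the `ℓ¹` norm of the coefficients is controlled by
the values on `(0, 1]`. -/
theorem exists_mul_sum_norm_le_norm_sum_pow_smul (n : ℕ) :
    ∃ κ > 0, ∀ q : ℕ → ℂ, ∃ t ∈ Set.Ioc (0 : ℝ) 1,
      κ * ∑ i ∈ range n, ‖q i‖ ≤ ‖∑ i ∈ range n, t ^ i • q i‖ := by
  rcases Nat.eq_zero_or_pos n with rfl | hn
  · exact ⟨1, one_pos, fun q => ⟨1, by simp, by simp⟩⟩
  have hn' : (0 : ℝ) < n := by exact_mod_cast hn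
  let t : Fin n → ℝ := fun i => ((i : ℕ) + 1) / n
  have ht : ∀ i, t i ∈ Set.Ioc (0 : ℝ) 1 := fun i => by
    refine ⟨by positivity, (div_le_one hn').2 ?_⟩
    exact_mod_cast i.2
  have htinj : Function.Injective fun i => (t i : ℂ) := fun i j hij => by
    have h : t i = t j := Complex.ofReal_injective hij
    have h' : ((i : ℕ) : ℝ) + 1 = (j : ℕ) + 1 := (div_left_inj' hn'.ne').1 h
    exact Fin.ext (by exact_mod_cast add_right_cancel h')
  let V : Matrix (Fin n) (Fin n) ℂ := Matrix.vandermonde fun i => (t i : ℂ)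
  have hV : IsUnit V := by
    rw [Matrix.isUnit_iff_isUnit_det, isUnit_iff_ne_zero]
    exact Matrix.det_vandermonde_ne_zero_iff.2 htinj
  obtain ⟨K, hK, hVK⟩ := V.mulVecLin.exists_antilipschitzWith
    (LinearMap.ker_eq_bot.2 (Matrix.mulVec_injective_of_isUnit hV))
  have hK' : (0 : ℝ) < K := by exact_mod_cast hK
  refine ⟨(n * K)⁻¹, by positivity, fun q => ?_⟩
  have : Nonempty (Fin n) := ⟨⟨0, hn⟩⟩
  let v : Fin n → ℂ := fun i => q i
  obtain ⟨i, hi⟩ : ∃ i, ‖V.mulVec v‖ ≤ ‖V.mulVec v i‖ := by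
    obtain ⟨i, hi⟩ := Finite.exists_max fun i => ‖V.mulVec v i‖
    exact ⟨i, (pi_norm_le_iff_of_nonempty _).2 hi⟩
  have hval : V.mulVec v i = ∑ k ∈ range n, t i ^ k • q k := by
    rw [← Fin.sum_univ_eq_sum_range fun k => t i ^ k • q k]
    simp [V, v, Matrix.mulVec, dotProduct, Matrix.vandermonde_apply]
  refine ⟨t i, ht i, ?_⟩
  have hv : ‖v‖ ≤ K * ‖V.mulVec v‖ := hVK.le_mul_norm (map_zero _) v
  have hsum : ∑ k ∈ range n, ‖q k‖ ≤ n * ‖v‖ := by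
    rw [← Fin.sum_univ_eq_sum_range fun k => ‖q k‖]
    refine (sum_le_card_nsmul univ _ ‖v‖ fun k _ => norm_le_pi_norm v k).trans ?_
    simp
  rw [← hval, inv_mul_le_iff₀ (by positivity)]
  calc ∑ k ∈ range n, ‖q k‖ ≤ n * (K * ‖V.mulVec v‖) := by grw [hsum, hv]
    _ ≤ n * K * ‖V.mulVec v i‖ := by grw [hi, mul_assoc]

open Set in
/-- Taylor's formula with remainder for the derivative of a function on `[0, δ)`, the bound on
the top derivative being assumed only on the interior. -/
theorem norm_iteratedDerivWithin_one_sub_taylor_le {E : Type*} [NormedAddCommGroup E]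
    [NormedSpace ℝ E] {n : ℕ} {δ B : ℝ} {f : ℝ → E}
    (hf : ContDiffOn ℝ ((n + 2 : ℕ) : ℕ∞) f (Ico 0 δ))
    (hB : ∀ x ∈ Ioo 0 δ, ‖iteratedDerivWithin (n + 2) f (Ico 0 δ) x‖ ≤ B)
    {x : ℝ} (hx : x ∈ Ioo 0 δ) :
    ‖iteratedDerivWithin 1 f (Ico 0 δ) x - ∑ k ∈ Finset.range (n + 1),
      x ^ k • ((k.factorial : ℝ)⁻¹ • iteratedDerivWithin (k + 1) f (Ico 0 δ) 0)‖ ≤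
        B * x ^ (n + 1) := by
  have hδ : 0 < δ := hx.1.trans hx.2
  have hu := uniqueDiffOn_Ico (0 : ℝ) δ
  have hB' : ∀ y ∈ Ico 0 δ, ‖iteratedDerivWithin (n + 2) f (Ico 0 δ) y‖ ≤ B := by
    intro y hy
    have hc : ContinuousOn (fun y => ‖iteratedDerivWithin (n + 2) f (Ico 0 δ) y‖) (Ico 0 δ) :=
      (hf.continuousOn_iteratedDerivWithin le_rfl hu).norm
    have hcl : y ∈ closure (Ioo 0 δ) := by
      rw [closure_Ioo hδ.ne]
      exact Ico_subset_Icc_self hy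
    have : (nhdsWithin y (Ioo 0 δ)).NeBot := mem_closure_iff_nhdsWithin_neBot.1 hcl
    exact le_of_tendsto ((hc y hy).mono Ioo_subset_Ico_self)
      (Filter.eventually_of_mem self_mem_nhdsWithin hB)
  have hB0 : 0 ≤ B := (norm_nonneg _).trans (hB x hx)
  have hsub : Icc 0 x ⊆ Ico 0 δ := fun y hy => ⟨hy.1, hy.2.trans_lt hx.2⟩
  set g := iteratedDerivWithin 1 f (Ico 0 δ) with hg
  have hgf : g = derivWithin f (Ico 0 δ) := by
    ext y
    rw [hg, iteratedDerivWithin_one]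
  have hgd : ContDiffOn ℝ (n + 1 : ℕ) g (Ico 0 δ) := by
    rw [hgf]
    exact hf.derivWithin hu (by norm_cast)
  have hder : ∀ k ≤ n + 1, ∀ y ∈ Icc 0 x, iteratedDerivWithin k g (Icc 0 x) y =
      iteratedDerivWithin (k + 1) f (Ico 0 δ) y := by
    intro k hk y hy
    have h : iteratedDerivWithin k g (Icc 0 x) y = iteratedDerivWithin k g (Ico 0 δ) y := by
      rw [iteratedDerivWithin, iteratedDerivWithin,
        iteratedFDerivWithin_subset hsub (uniqueDiffOn_Icc hx.1) hu
          (hgd.of_le (by exact_mod_cast hk)) hy]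
    rw [h, iteratedDerivWithin_succ', hgf]
  have hT := taylor_mean_remainder_bound (f := g) (n := n) (C := B) hx.1.le
    (by exact_mod_cast hgd.mono hsub) (right_mem_Icc.2 hx.1.le)
    (fun y hy => (hder (n + 1) le_rfl y hy).symm ▸ hB' y (hsub hy))
  rw [taylor_within_apply, sub_zero] at hT
  refine le_trans (le_of_eq ?_) (hT.trans (div_le_self (by positivity [hx.1]) ?_))
  · congr 2
    refine Finset.sum_congr rfl fun k hk => ?_
    rw [hder k (Finset.mem_range.1 hk).le 0 (left_mem_Icc.2 hx.1.le), mul_comm, mul_smul]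
  · exact_mod_cast n.factorial_pos


/-- Let `γ ≥ 2` and let `F(ρ,μ)` be complex valued, `C^{γ+1}`
in `ρ` on `[0,δ)`, satisfying (F1)–(F4), and let
`π(ρ,μ) = ∑_{j=2}^γ j |a_j(μ)| ρ^{j-1}` where `a_j(μ) = ∂_ρ^j F(0,μ)/j!`.
Then, for `δ > 0` sufficiently small (depending only on `γ` and the constants
`C₀` of (F2) and `M_k` of (F4)), there is a constant `C > 0` with
`|∂_ρ F(ρ,μ)| ≥ C π(ρ,μ)` for all `0 < ρ < δ` and all `μ`. -/
theorem stmt_4 (γ : ℕ) (hγ : 2 ≤ γ) (P : Type*) [Nonempty P]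
    (C₀ : ℝ) (hC₀ : 0 < C₀) (M : ℕ → ℝ) :
    ∃ δ₀ > 0, ∀ δ : ℝ, 0 < δ → δ ≤ δ₀ →
      ∀ F : P → ℝ → ℂ,
        -- `F(·,μ)` is `C^{γ+1}` on `[0,δ)`
        (∀ μ, ContDiffOn ℝ ((γ + 1 : ℕ) : ℕ∞) (F μ) (Set.Ico 0 δ)) →
        -- (F1): `a₀(μ) = a₁(μ) = 0`
        (∀ μ, iteratedDerivWithin 0 (F μ) (Set.Ico 0 δ) 0 = 0 ∧
              iteratedDerivWithin 1 (F μ) (Set.Ico 0 δ) 0 = 0) →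
        -- (F2): `∑_{j=2}^γ |a_j(μ)| ≥ C₀`
        (∀ μ, C₀ ≤ ∑ j ∈ Finset.Icc 2 γ,
              ‖iteratedDerivWithin j (F μ) (Set.Ico 0 δ) 0 / (j.factorial : ℂ)‖) →
        -- (F3): `|∂_ρ F(ρ,μ)|` is increasing in `ρ` on `(0,δ)`
        (∀ μ, MonotoneOn
              (fun ρ => ‖iteratedDerivWithin 1 (F μ) (Set.Ico 0 δ) ρ‖)
              (Set.Ioo 0 δ)) →
        -- (F4): `|∂_ρ^k F(ρ,μ)| ≤ M_k` on `(0,δ)` for `k ≤ γ+1`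
        (∀ k : ℕ, k ≤ γ + 1 → ∀ μ, ∀ ρ ∈ Set.Ioo (0:ℝ) δ,
              ‖iteratedDerivWithin k (F μ) (Set.Ico 0 δ) ρ‖ ≤ M k) →
        ∃ C > 0, ∀ μ, ∀ ρ ∈ Set.Ioo (0:ℝ) δ,
          C * (∑ j ∈ Finset.Icc 2 γ, (j : ℝ) *
                ‖iteratedDerivWithin j (F μ) (Set.Ico 0 δ) 0 / (j.factorial : ℂ)‖ *
                ρ ^ (j - 1)) ≤
            ‖iteratedDerivWithin 1 (F μ) (Set.Ico 0 δ) ρ‖ := by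
  obtain ⟨n, rfl⟩ : ∃ n, γ = n + 1 := ⟨γ - 1, by omega⟩
  obtain ⟨κ, hκ, hpoly⟩ := exists_mul_sum_norm_le_norm_sum_pow_smul (n + 1)
  let B : ℝ := max (M (n + 2)) 1
  have hB : 0 < B := lt_max_of_lt_right one_pos
  refine ⟨min 1 (κ * C₀ / (2 * B)), by positivity, ?_⟩
  intro δ hδ hδ₀ F hF hF1 hF2 hF3 hF4
  refine ⟨κ / 2, by positivity, fun μ ρ hρ => ?_⟩
  set D : ℕ → ℂ := fun j => iteratedDerivWithin j (F μ) (Set.Ico 0 δ) 0 with hD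
  let b : ℕ → ℂ := fun k => (k.factorial : ℝ)⁻¹ • D (k + 1)
  have hb0 : b 0 = 0 := by simp [b, hD, (hF1 μ).2]
  have hb : ∀ k, ‖b k‖ = (k + 1 : ℕ) * ‖D (k + 1) / ((k + 1).factorial : ℂ)‖ := fun k => by
    have : (0 : ℝ) < k.factorial := by exact_mod_cast k.factorial_pos
    simp only [b, norm_smul, norm_inv, norm_div, Complex.norm_natCast, Nat.factorial_succ,
      Nat.cast_mul, Real.norm_natCast, norm_mul]
    field_simp
  have hreindex : ∀ f : ℕ → ℝ, f 1 = 0 →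
      ∑ j ∈ Finset.Icc 2 (n + 1), f j = ∑ k ∈ Finset.range (n + 1), f (k + 1) := fun f hf => by
    rw [Finset.sum_range_succ', hf, add_zero, ← Finset.Ico_add_one_right_eq_Icc,
      Finset.sum_Ico_eq_sum_range]
    exact Finset.sum_congr (by simp) fun k _ => by rw [add_comm 2 k]
  set S : ℝ := ∑ k ∈ Finset.range (n + 1), ‖ρ ^ k • b k‖ with hS
  have hsum : ∑ j ∈ Finset.Icc 2 (n + 1), (j : ℝ) * ‖D j / (j.factorial : ℂ)‖ * ρ ^ (j - 1) =
      S := by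
    rw [hreindex _ (by simp [hD, (hF1 μ).2])]
    refine Finset.sum_congr rfl fun k _ => ?_
    rw [norm_smul, hb, norm_pow, Real.norm_of_nonneg hρ.1.le, add_tsub_cancel_right, mul_comm]
  have hρ1 : ρ ≤ 1 := hρ.2.le.trans (hδ₀.trans (min_le_left _ _))
  have hS_lower : C₀ * ρ ^ n ≤ S := by
    calc C₀ * ρ ^ n
        ≤ (∑ j ∈ Finset.Icc 2 (n + 1), ‖D j / (j.factorial : ℂ)‖) * ρ ^ n :=
          mul_le_mul_of_nonneg_right (hF2 μ) (pow_nonneg hρ.1.le _)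
      _ ≤ S := by
          rw [← hsum, Finset.sum_mul]
          refine Finset.sum_le_sum fun j hj => ?_
          rw [Finset.mem_Icc] at hj
          refine mul_le_mul (le_mul_of_one_le_left (norm_nonneg _) ?_)
            (pow_le_pow_of_le_one hρ.1.le hρ1 (by omega)) (pow_nonneg hρ.1.le _) (by positivity)
          exact_mod_cast (by omega : 1 ≤ j)
  rw [hsum]
  obtain ⟨t, ht, hpt⟩ := hpoly fun k => ρ ^ k • b k
  have htρ : t * ρ ≤ ρ := mul_le_of_le_one_left hρ.1.le ht.2
  have htρ' : t * ρ ∈ Set.Ioo 0 δ := ⟨mul_pos ht.1 hρ.1, htρ.trans_lt hρ.2⟩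
  have hmono := hF3 μ htρ' hρ htρ
  have hT := norm_iteratedDerivWithin_one_sub_taylor_le (hF μ)
    (fun x hx => (hF4 (n + 2) le_rfl μ x hx).trans (le_max_left _ 1)) htρ'
  have hP : ∑ k ∈ Finset.range (n + 1), t ^ k • ρ ^ k • b k =
      ∑ k ∈ Finset.range (n + 1), (t * ρ) ^ k • b k :=
    Finset.sum_congr rfl fun k _ => by rw [mul_pow, mul_smul]
  rw [hP] at hpt
  have hrem : B * (t * ρ) ^ (n + 1) ≤ κ / 2 * S := by
    have hρB : B * ρ ≤ κ / 2 * C₀ := by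
      have h := hρ.2.le.trans (hδ₀.trans (min_le_right _ _))
      rw [le_div_iff₀ (by positivity)] at h
      linarith
    have hρn := pow_nonneg hρ.1.le n
    calc B * (t * ρ) ^ (n + 1) ≤ B * ρ ^ (n + 1) :=
          mul_le_mul_of_nonneg_left (pow_le_pow_left₀ htρ'.1.le htρ _) hB.le
      _ = B * ρ * ρ ^ n := by ring
      _ ≤ κ / 2 * C₀ * ρ ^ n := mul_le_mul_of_nonneg_right hρB hρn
      _ = κ / 2 * (C₀ * ρ ^ n) := by ring
      _ ≤ κ / 2 * S := mul_le_mul_of_nonneg_left hS_lower (by positivity)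
  have htri := norm_sub_norm_le (∑ k ∈ Finset.range (n + 1), (t * ρ) ^ k • b k)
    (iteratedDerivWithin 1 (F μ) (Set.Ico 0 δ) (t * ρ))
  rw [norm_sub_rev] at htri
  have hT' := hT.trans hrem
  dsimp only at hmono
  linarith
end

section
/- Let N ≥ 1, γ ≥ 2 be integers, δ > 0, and set l = [N/γ] + 1. Let F(ρ) be a complex-valued function of class C^{l·γ + 1} on (0,δ) with Im F(ρ) ≥ 0, and suppose there are constants c, C_m > 0 such that |F′(ρ)| ≥ c ρ^{γ-1} and |F^{(m)}(ρ)| ≤ C_m ρ^{1-m} |F′(ρ)| for all 0 < ρ < δ and all m with 2 ≤ m ≤ l·γ. Let g ∈ C^l have compact support contained in {ρ : (1/2) λ^{-1/γ} ≤ ρ < δ} and satisfy |g^{(r)}(ρ)| ≤ A ρ^{N-1-r} for all 0 ≤ r ≤ l and all ρ in its support. Then there exists a constant C = C_{N,γ} > 0 (depending only on N, γ, c, the C_m, and A) such that for all λ ≥ 1, |∫_0^∞ e^{iλF(ρ)} g(ρ) dρ| ≤ C λ^{-N/γ}. -/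
open MeasureTheory Set

/-- `f` has `n` derivatives on `(0,δ)`, and its `r`-th derivative is bounded by `K ρ^(p-r)` there
for `r ≤ n`. -/
def SymbolBound (δ : ℝ) : ℕ → ℝ → ℤ → (ℝ → ℂ) → Prop
  | 0, K, p, f => ContinuousOn f (Ioo 0 δ) ∧ ∀ ρ ∈ Ioo 0 δ, ‖f ρ‖ ≤ K * ρ ^ p
  | n + 1, K, p, f => DifferentiableOn ℝ f (Ioo 0 δ) ∧ (∀ ρ ∈ Ioo 0 δ, ‖f ρ‖ ≤ K * ρ ^ p) ∧
      SymbolBound δ n K (p - 1) (deriv f)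

namespace SymbolBound

variable {δ : ℝ} {n : ℕ} {K L : ℝ} {p q : ℤ} {f g : ℝ → ℂ}

lemma continuousOn (h : SymbolBound δ n K p f) : ContinuousOn f (Ioo 0 δ) := by
  cases n with
  | zero => exact h.1
  | succ n => exact h.1.continuousOn

lemma norm_le (h : SymbolBound δ n K p f) : ∀ ρ ∈ Ioo 0 δ, ‖f ρ‖ ≤ K * ρ ^ p := by
  cases n with
  | zero => exact h.2
  | succ n => exact h.2.1

lemma of_succ (h : SymbolBound δ (n + 1) K p f) : SymbolBound δ n K p f := by
  induction n generalizing p f with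
  | zero => exact ⟨h.continuousOn, h.norm_le⟩
  | succ n ih => exact ⟨h.1, h.norm_le, ih h.2.2⟩

lemma mono (h : SymbolBound δ n K p f) (hKL : K ≤ L) : SymbolBound δ n L p f := by
  have key (f : ℝ → ℂ) (p : ℤ) (h : ∀ ρ ∈ Ioo 0 δ, ‖f ρ‖ ≤ K * ρ ^ p) :
      ∀ ρ ∈ Ioo 0 δ, ‖f ρ‖ ≤ L * ρ ^ p := fun ρ hρ =>
    (h ρ hρ).trans (mul_le_mul_of_nonneg_right hKL (zpow_nonneg hρ.1.le p))
  induction n generalizing p f with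
  | zero => exact ⟨h.1, key f p h.2⟩
  | succ n ih => exact ⟨h.1, key f p h.2.1, ih h.2.2⟩

lemma congr (h : SymbolBound δ n K p f) (hfg : EqOn g f (Ioo 0 δ)) : SymbolBound δ n K p g := by
  induction n generalizing p f g with
  | zero => exact ⟨h.1.congr hfg, fun ρ hρ => hfg hρ ▸ h.2 ρ hρ⟩
  | succ n ih =>
    refine ⟨h.1.congr hfg, fun ρ hρ => hfg hρ ▸ h.2.1 ρ hρ, ih h.2.2 fun ρ hρ => ?_⟩
    exact (hfg.eventuallyEq_of_mem (isOpen_Ioo.mem_nhds hρ)).deriv_eq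

lemma differentiableAt (h : SymbolBound δ (n + 1) K p f) {ρ : ℝ} (hρ : ρ ∈ Ioo 0 δ) :
    DifferentiableAt ℝ f ρ :=
  h.1.differentiableAt (isOpen_Ioo.mem_nhds hρ)

lemma add (hf : SymbolBound δ n K p f) (hg : SymbolBound δ n L p g) :
    SymbolBound δ n (K + L) p (fun ρ => f ρ + g ρ) := by
  have key (f g : ℝ → ℂ) (p : ℤ) (hf : ∀ ρ ∈ Ioo 0 δ, ‖f ρ‖ ≤ K * ρ ^ p)
      (hg : ∀ ρ ∈ Ioo 0 δ, ‖g ρ‖ ≤ L * ρ ^ p) :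
      ∀ ρ ∈ Ioo 0 δ, ‖f ρ + g ρ‖ ≤ (K + L) * ρ ^ p := fun ρ hρ => by
    rw [add_mul]
    exact (norm_add_le _ _).trans (add_le_add (hf ρ hρ) (hg ρ hρ))
  induction n generalizing p f g with
  | zero => exact ⟨hf.1.add hg.1, key f g p hf.2 hg.2⟩
  | succ n ih =>
    exact ⟨hf.1.add hg.1, key f g p hf.2.1 hg.2.1, (ih hf.2.2 hg.2.2).congr fun ρ hρ =>
      deriv_fun_add (hf.differentiableAt hρ) (hg.differentiableAt hρ)⟩

lemma neg (hf : SymbolBound δ n K p f) : SymbolBound δ n K p (fun ρ => -f ρ) := by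
  induction n generalizing p f with
  | zero => exact ⟨hf.1.neg, fun ρ hρ => (norm_neg (f ρ)).trans_le (hf.2 ρ hρ)⟩
  | succ n ih =>
    exact ⟨hf.1.neg, fun ρ hρ => (norm_neg (f ρ)).trans_le (hf.2.1 ρ hρ),
      (ih hf.2.2).congr fun ρ _ => deriv.fun_neg⟩

lemma mul (hK : 0 ≤ K) (hL : 0 ≤ L) (hf : SymbolBound δ n K p f) (hg : SymbolBound δ n L q g) :
    SymbolBound δ n (2 ^ n * (K * L)) (p + q) (fun ρ => f ρ * g ρ) := by
  have key (m : ℕ) (f g : ℝ → ℂ) (p q : ℤ) (hf : ∀ ρ ∈ Ioo 0 δ, ‖f ρ‖ ≤ K * ρ ^ p)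
      (hg : ∀ ρ ∈ Ioo 0 δ, ‖g ρ‖ ≤ L * ρ ^ q) :
      ∀ ρ ∈ Ioo 0 δ, ‖f ρ * g ρ‖ ≤ 2 ^ m * (K * L) * ρ ^ (p + q) := fun ρ hρ => by
    have hρ0 : 0 < ρ := hρ.1
    rw [norm_mul, zpow_add₀ hρ0.ne']
    calc ‖f ρ‖ * ‖g ρ‖ ≤ (K * ρ ^ p) * (L * ρ ^ q) :=
          mul_le_mul (hf ρ hρ) (hg ρ hρ) (norm_nonneg _) (by positivity)
      _ = 1 * ((K * L) * (ρ ^ p * ρ ^ q)) := by ring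
      _ ≤ 2 ^ m * ((K * L) * (ρ ^ p * ρ ^ q)) :=
          mul_le_mul_of_nonneg_right (one_le_pow₀ one_le_two) (by positivity)
      _ = _ := by ring
  induction n generalizing p q f g with
  | zero => exact ⟨hf.1.mul hg.1, key 0 f g p q hf.2 hg.2⟩
  | succ n ih =>
    refine ⟨hf.1.mul hg.1, key _ f g p q hf.2.1 hg.2.1, ?_⟩
    have h₁ := ih hf.2.2 hg.of_succ
    have h₂ := ih hf.of_succ hg.2.2
    rw [show p - 1 + q = p + q - 1 by ring] at h₁
    rw [show p + (q - 1) = p + q - 1 by ring] at h₂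
    rw [show (2 : ℝ) ^ (n + 1) * (K * L) = 2 ^ n * (K * L) + 2 ^ n * (K * L) by ring]
    exact (h₁.add h₂).congr fun ρ hρ =>
      deriv_fun_mul (hf.differentiableAt hρ) (hg.differentiableAt hρ)

end SymbolBound

lemma symbolBound_iteratedDeriv {δ A : ℝ} {l : ℕ} {p : ℤ} {g : ℝ → ℂ} (hg : ContDiff ℝ l g)
    (hb : ∀ r ≤ l, ∀ ρ ∈ Ioo 0 δ, ‖iteratedDeriv r g ρ‖ ≤ A * ρ ^ (p - (r : ℤ)))
    (n r : ℕ) (hnr : n + r ≤ l) : SymbolBound δ n A (p - r) (iteratedDeriv r g) := by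
  induction n generalizing r with
  | zero =>
    exact ⟨(hg.continuous_iteratedDeriv r (by exact_mod_cast (by omega : r ≤ l))).continuousOn,
      hb r (by omega)⟩
  | succ n ih =>
    refine ⟨(hg.differentiable_iteratedDeriv r
      (by exact_mod_cast (by omega : r < l))).differentiableOn, hb r (by omega), ?_⟩
    rw [← iteratedDeriv_succ, show p - (r : ℤ) - 1 = p - ((r + 1 : ℕ) : ℤ) by push_cast; ring]
    exact ih (r + 1) (by omega)

lemma ContDiffOn.differentiableAt_iteratedDeriv_Ioo {a b : ℝ} {M m : ℕ} {F : ℝ → ℂ}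
    (hF : ContDiffOn ℝ M F (Ioo a b)) (hm : m < M) {ρ : ℝ} (hρ : ρ ∈ Ioo a b) :
    DifferentiableAt ℝ (iteratedDeriv m F) ρ :=
  ((hF.differentiableOn_iteratedDerivWithin (m := m) (by exact_mod_cast hm)
    isOpen_Ioo.uniqueDiffOn).congr fun _ hx =>
      (iteratedDerivWithin_of_isOpen isOpen_Ioo hx).symm).differentiableAt
    (isOpen_Ioo.mem_nhds hρ)

/-- The quotients `F⁽ᵐ⁾ / F′` satisfy symbol bounds of order `1 - m`, because
`(F⁽ᵐ⁾ / F′)′ = F⁽ᵐ⁺¹⁾ / F′ - (F⁽ᵐ⁾ / F′) (F″ / F′)`. -/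
lemma exists_symbolBound_iteratedDeriv_div_deriv (M : ℕ) (Cm : ℕ → ℝ) (hCm : ∀ m, 0 < Cm m)
    (n m : ℕ) (hm : 2 ≤ m) (hnm : n + m ≤ M) :
    ∃ K, 0 ≤ K ∧ ∀ (δ : ℝ) (F : ℝ → ℂ), ContDiffOn ℝ (M + 1 : ℕ) F (Ioo 0 δ) →
      (∀ ρ ∈ Ioo 0 δ, deriv F ρ ≠ 0) →
      (∀ m : ℕ, 2 ≤ m → m ≤ M → ∀ ρ ∈ Ioo (0 : ℝ) δ,
        ‖iteratedDeriv m F ρ‖ ≤ Cm m * ρ ^ (1 - (m : ℤ)) * ‖deriv F ρ‖) →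
      SymbolBound δ n K (1 - (m : ℤ)) (fun ρ => iteratedDeriv m F ρ / deriv F ρ) := by
  have hdiff {m : ℕ} (hmM : m ≤ M) {δ : ℝ} {F : ℝ → ℂ}
      (hF : ContDiffOn ℝ (M + 1 : ℕ) F (Ioo 0 δ)) {ρ : ℝ} (hρ : ρ ∈ Ioo 0 δ) :
      DifferentiableAt ℝ (iteratedDeriv m F) ρ :=
    hF.differentiableAt_iteratedDeriv_Ioo (by omega) hρ
  have hdiff1 (hM : 1 ≤ M) {δ : ℝ} {F : ℝ → ℂ}
      (hF : ContDiffOn ℝ (M + 1 : ℕ) F (Ioo 0 δ)) {ρ : ℝ} (hρ : ρ ∈ Ioo 0 δ) :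
      DifferentiableAt ℝ (deriv F) ρ := by
    simpa only [iteratedDeriv_one] using hdiff hM hF hρ
  have hbound {m : ℕ} {δ : ℝ} {F : ℝ → ℂ} (hF0 : ∀ ρ ∈ Ioo 0 δ, deriv F ρ ≠ 0)
      (hb : ∀ ρ ∈ Ioo (0 : ℝ) δ,
        ‖iteratedDeriv m F ρ‖ ≤ Cm m * ρ ^ (1 - (m : ℤ)) * ‖deriv F ρ‖) :
      ∀ ρ ∈ Ioo (0 : ℝ) δ,
        ‖iteratedDeriv m F ρ / deriv F ρ‖ ≤ Cm m * ρ ^ (1 - (m : ℤ)) := fun ρ hρ => by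
    rw [norm_div, div_le_iff₀ (norm_pos_iff.2 (hF0 ρ hρ))]
    exact hb ρ hρ
  induction n generalizing m with
  | zero =>
    refine ⟨Cm m, (hCm m).le, fun δ F hF hF0 hb => ⟨fun ρ hρ => ?_,
      hbound hF0 (hb m hm (by omega))⟩⟩
    exact ((hdiff (by omega) hF hρ).div (hdiff1 (by omega) hF hρ)
      (hF0 ρ hρ)).continuousAt.continuousWithinAt
  | succ n ih =>
    obtain ⟨K₁, hK₁, h₁⟩ := ih (m + 1) (by omega) (by omega)
    obtain ⟨K₂, hK₂, h₂⟩ := ih m hm (by omega)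
    obtain ⟨K₃, hK₃, h₃⟩ := ih 2 le_rfl (by omega)
    have hK : 0 ≤ K₁ + 2 ^ n * (K₂ * K₃) := by positivity
    refine ⟨Cm m + (K₁ + 2 ^ n * (K₂ * K₃)), add_nonneg (hCm m).le hK, fun δ F hF hF0 hb =>
      ⟨fun ρ hρ => ((hdiff (by omega) hF hρ).div (hdiff1 (by omega) hF hρ)
        (hF0 ρ hρ)).differentiableWithinAt, fun ρ hρ => ?_, ?_⟩⟩
    · exact (hbound hF0 (hb m hm (by omega)) ρ hρ).trans
        (mul_le_mul_of_nonneg_right (le_add_of_nonneg_right hK) (zpow_nonneg hρ.1.le _))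
    · have e₁ := h₁ δ F hF hF0 hb
      have e₂ := ((h₂ δ F hF hF0 hb).mul hK₂ hK₃ (h₃ δ F hF hF0 hb)).neg
      rw [show 1 - ((m + 1 : ℕ) : ℤ) = 1 - (m : ℤ) - 1 by push_cast; ring] at e₁
      rw [show 1 - (m : ℤ) + (1 - ((2 : ℕ) : ℤ)) = 1 - (m : ℤ) - 1 by push_cast; ring] at e₂
      refine ((e₁.add e₂).mono (le_add_of_nonneg_left (hCm m).le)).congr fun ρ hρ => ?_
      have h0 := hF0 ρ hρ
      simp only
      rw [deriv_fun_div (hdiff (by omega) hF hρ) (hdiff1 (by omega) hF hρ) h0,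
        iteratedDeriv_succ, show iteratedDeriv 2 F = deriv (deriv F) by
          rw [iteratedDeriv_succ, iteratedDeriv_one]]
      field_simp
      ring

lemma exists_symbolBound_inv_deriv (M γ : ℕ) (c : ℝ) (hc : 0 < c) (hγ : 1 ≤ γ)
    (Cm : ℕ → ℝ) (hCm : ∀ m, 0 < Cm m) (n : ℕ) (hn : n + 1 ≤ M) :
    ∃ K, 0 ≤ K ∧ ∀ (δ : ℝ) (F : ℝ → ℂ), ContDiffOn ℝ (M + 1 : ℕ) F (Ioo 0 δ) →
      (∀ ρ ∈ Ioo (0 : ℝ) δ, c * ρ ^ (γ - 1) ≤ ‖deriv F ρ‖) →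
      (∀ m : ℕ, 2 ≤ m → m ≤ M → ∀ ρ ∈ Ioo (0 : ℝ) δ,
        ‖iteratedDeriv m F ρ‖ ≤ Cm m * ρ ^ (1 - (m : ℤ)) * ‖deriv F ρ‖) →
      SymbolBound δ n K (1 - (γ : ℤ)) (fun ρ => (deriv F ρ)⁻¹) := by
  have hne {δ : ℝ} {F : ℝ → ℂ} (hb : ∀ ρ ∈ Ioo (0 : ℝ) δ, c * ρ ^ (γ - 1) ≤ ‖deriv F ρ‖) :
      ∀ ρ ∈ Ioo (0 : ℝ) δ, deriv F ρ ≠ 0 := fun ρ hρ =>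
    norm_pos_iff.1 ((mul_pos hc (pow_pos hρ.1 _)).trans_le (hb ρ hρ))
  have hdiff {δ : ℝ} {F : ℝ → ℂ}
      (hF : ContDiffOn ℝ (M + 1 : ℕ) F (Ioo 0 δ)) {ρ : ℝ} (hρ : ρ ∈ Ioo 0 δ) :
      DifferentiableAt ℝ (deriv F) ρ := by
    simpa only [iteratedDeriv_one] using
      hF.differentiableAt_iteratedDeriv_Ioo (m := 1) (by omega) hρ
  have hbound {δ : ℝ} {F : ℝ → ℂ}
      (hb : ∀ ρ ∈ Ioo (0 : ℝ) δ, c * ρ ^ (γ - 1) ≤ ‖deriv F ρ‖) :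
      ∀ ρ ∈ Ioo (0 : ℝ) δ, ‖(deriv F ρ)⁻¹‖ ≤ c⁻¹ * ρ ^ (1 - (γ : ℤ)) := fun ρ hρ => by
    rw [norm_inv, show 1 - (γ : ℤ) = -((γ - 1 : ℕ) : ℤ) by omega, zpow_neg, zpow_natCast,
      ← mul_inv]
    exact inv_anti₀ (mul_pos hc (pow_pos hρ.1 _)) (hb ρ hρ)
  induction n with
  | zero =>
    exact ⟨c⁻¹, (inv_pos.2 hc).le, fun δ F hF hb _ => ⟨fun ρ hρ =>
      ((hdiff hF hρ).inv (hne hb ρ hρ)).continuousAt.continuousWithinAt, hbound hb⟩⟩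
  | succ n ih =>
    obtain ⟨K₁, hK₁, h₁⟩ := ih (by omega)
    obtain ⟨K₂, hK₂, h₂⟩ :=
      exists_symbolBound_iteratedDeriv_div_deriv M Cm hCm n 2 le_rfl (by omega)
    have hK : 0 ≤ 2 ^ n * (K₁ * K₂) := by positivity
    have hc' : 0 ≤ c⁻¹ := (inv_pos.2 hc).le
    refine ⟨c⁻¹ + 2 ^ n * (K₁ * K₂), add_nonneg hc' hK, fun δ F hF hb hm => ⟨fun ρ hρ =>
      ((hdiff hF hρ).inv (hne hb ρ hρ)).differentiableWithinAt, fun ρ hρ => ?_, ?_⟩⟩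
    · exact (hbound hb ρ hρ).trans
        (mul_le_mul_of_nonneg_right (le_add_of_nonneg_right hK) (zpow_nonneg hρ.1.le _))
    · have e := ((h₁ δ F hF hb hm).mul hK₁ hK₂ (h₂ δ F hF (hne hb) hm)).neg
      rw [show 1 - (γ : ℤ) + (1 - ((2 : ℕ) : ℤ)) = 1 - (γ : ℤ) - 1 by push_cast; ring] at e
      refine (e.mono (le_add_of_nonneg_left hc')).congr fun ρ hρ => ?_
      have h0 := hne hb ρ hρ
      simp only
      rw [deriv_fun_inv'' (hdiff hF hρ) h0, show iteratedDeriv 2 F = deriv (deriv F) by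
          rw [iteratedDeriv_succ, iteratedDeriv_one]]
      field_simp

/-- One integration by parts against `e^{iλF}`, for an amplitude supported inside `(0,δ)`. -/
lemma integral_exp_mul_eq {δ lam : ℝ} (hlam : lam ≠ 0) {F h : ℝ → ℂ} {S : Set ℝ}
    (hS : IsCompact S) (hSδ : S ⊆ Ioo 0 δ) (hh : tsupport h ⊆ S)
    (hF : DifferentiableOn ℝ F (Ioo 0 δ)) (hF0 : ∀ ρ ∈ Ioo 0 δ, deriv F ρ ≠ 0)
    (hc : ContinuousOn h (Ioo 0 δ))
    (hd : DifferentiableOn ℝ (fun ρ => h ρ * (deriv F ρ)⁻¹) (Ioo 0 δ))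
    (hd' : ContinuousOn (deriv fun ρ => h ρ * (deriv F ρ)⁻¹) (Ioo 0 δ)) :
    ∫ ρ, Complex.exp (Complex.I * lam * F ρ) * h ρ =
      Complex.I / lam * ∫ ρ, Complex.exp (Complex.I * lam * F ρ) *
        deriv (fun ρ => h ρ * (deriv F ρ)⁻¹) ρ := by
  set w : ℝ → ℂ := fun ρ => h ρ * (deriv F ρ)⁻¹ with hw
  set e : ℝ → ℂ := fun ρ => Complex.exp (Complex.I * lam * F ρ)
  have heD {ρ : ℝ} (hρ : ρ ∈ Ioo 0 δ) :
      HasDerivAt e (e ρ * (Complex.I * lam * deriv F ρ)) ρ :=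
    ((hF.differentiableAt (isOpen_Ioo.mem_nhds hρ)).hasDerivAt.const_mul _).cexp
  have hw_supp : tsupport w ⊆ S := (tsupport_mul_subset_left).trans hh
  have hw'_supp : tsupport (deriv w) ⊆ S := (tsupport_deriv_subset (𝕜 := ℝ) (f := w)).trans hw_supp
  have hcont {u : ℝ → ℂ} (hu : ContinuousOn u (Ioo 0 δ)) (hus : tsupport u ⊆ S) :
      Continuous (fun ρ => e ρ * u ρ) := by
    refine continuous_of_tsupport fun ρ hρ => ?_
    have hρ' : ρ ∈ Ioo 0 δ := hSδ (hus (tsupport_mul_subset_right hρ))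
    exact (heD hρ').continuousAt.mul (hu.continuousAt (isOpen_Ioo.mem_nhds hρ'))
  have hint {u : ℝ → ℂ} (hu : ContinuousOn u (Ioo 0 δ)) (hus : tsupport u ⊆ S) :
      Integrable (fun ρ => e ρ * u ρ) :=
    (hcont hu hus).integrable_of_hasCompactSupport
      (hS.of_isClosed_subset (isClosed_tsupport _) (tsupport_mul_subset_right.trans hus))
  have hI₁ := hint hc hh
  have hI₂ := hint hd' hw'_supp
  have hI₃ := hint hd.continuousOn hw_supp
  have hder (ρ : ℝ) : HasDerivAt (fun ρ => e ρ * w ρ)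
      (Complex.I * lam * (e ρ * h ρ) + e ρ * deriv w ρ) ρ := by
    by_cases hρ : ρ ∈ Ioo 0 δ
    · have h0 := hF0 ρ hρ
      refine ((heD hρ).mul
        (hd.differentiableAt (isOpen_Ioo.mem_nhds hρ)).hasDerivAt).congr_deriv ?_
      rw [show h ρ = w ρ * deriv F ρ by simp only [hw]; field_simp]
      ring
    · have hρS : ρ ∉ S := fun h => hρ (hSδ h)
      have h1 : h ρ = 0 := image_eq_zero_of_notMem_tsupport fun h => hρS (hh h)
      have h2 : deriv w ρ = 0 := image_eq_zero_of_notMem_tsupport fun h => hρS (hw'_supp h)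
      rw [h1, h2, mul_zero, mul_zero, add_zero]
      refine (hasDerivAt_const ρ (0 : ℂ)).congr_of_eventuallyEq ?_
      filter_upwards [hS.isClosed.isOpen_compl.mem_nhds hρS] with x hx
      have : w x = 0 := image_eq_zero_of_notMem_tsupport fun h => hx (hw_supp h)
      rw [this, mul_zero]
  have hzero := integral_eq_zero_of_hasDerivAt_of_integrable hder
    ((hI₁.const_mul _).add hI₂) hI₃
  rw [integral_add (hI₁.const_mul _) hI₂, integral_const_mul] at hzero
  have hl : (lam : ℂ) ≠ 0 := by exact_mod_cast hlam
  have hI : Complex.I / lam * (Complex.I * lam) = -1 := by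
    rw [div_mul_eq_mul_div, ← mul_assoc, Complex.I_mul_I, mul_div_assoc, div_self hl, mul_one]
  linear_combination (-Complex.I / lam) * hzero + (∫ ρ, e ρ * h ρ) * hI

lemma iteratedDeriv_eq_zero_of_notMem_tsupport {g : ℝ → ℂ} {r : ℕ} {ρ : ℝ} (hρ : ρ ∉ tsupport g) :
    iteratedDeriv r g ρ = 0 := by
  have h : iteratedFDeriv ℝ r g ρ = 0 :=
    Function.notMem_support.1 fun h => hρ (support_iteratedFDeriv_subset r h)
  rw [iteratedDeriv_eq_iteratedFDeriv, h]
  rfl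

/-- Repeated integration by parts: `k` steps gain `λ^(-k)` and cost `ρ^(-γk)` in the amplitude. -/
lemma exists_integral_exp_mul_eq_pow_mul (M γ l k n : ℕ) (p : ℤ) (c A : ℝ) (hc : 0 < c)
    (hγ : 1 ≤ γ) (hA : 0 ≤ A) (Cm : ℕ → ℝ) (hCm : ∀ m, 0 < Cm m) (hl : l + 1 ≤ M)
    (hnk : n + k = l) :
    ∃ K, 0 ≤ K ∧ ∀ (δ : ℝ) (F g : ℝ → ℂ) (lam : ℝ), lam ≠ 0 →
      ContDiffOn ℝ (M + 1 : ℕ) F (Ioo 0 δ) →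
      (∀ ρ ∈ Ioo (0 : ℝ) δ, c * ρ ^ (γ - 1) ≤ ‖deriv F ρ‖) →
      (∀ m : ℕ, 2 ≤ m → m ≤ M → ∀ ρ ∈ Ioo (0 : ℝ) δ,
        ‖iteratedDeriv m F ρ‖ ≤ Cm m * ρ ^ (1 - (m : ℤ)) * ‖deriv F ρ‖) →
      SymbolBound δ l A p g → HasCompactSupport g → tsupport g ⊆ Ioo 0 δ →
      ∃ h : ℝ → ℂ, SymbolBound δ n K (p - γ * k) h ∧ tsupport h ⊆ tsupport g ∧
        ∫ ρ, Complex.exp (Complex.I * lam * F ρ) * g ρ =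
          (Complex.I / lam) ^ k * ∫ ρ, Complex.exp (Complex.I * lam * F ρ) * h ρ := by
  induction k generalizing n with
  | zero =>
    refine ⟨A, hA, fun δ F g lam _ _ _ _ hg _ _ => ⟨g, ?_, subset_rfl, by simp⟩⟩
    obtain rfl : n = l := by omega
    simpa using hg
  | succ k ih =>
    obtain ⟨K₁, hK₁, h₁⟩ := ih (n + 1) (by omega)
    obtain ⟨K₂, hK₂, h₂⟩ := exists_symbolBound_inv_deriv M γ c hc hγ Cm hCm (n + 1) (by omega)
    refine ⟨2 ^ (n + 1) * (K₁ * K₂), by positivity, fun δ F g lam hlam hF hb hm hg hgc hgδ => ?_⟩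
    obtain ⟨h, hh, hsupp, heq⟩ := h₁ δ F g lam hlam hF hb hm hg hgc hgδ
    have hw := hh.mul hK₁ hK₂ (h₂ δ F hF hb hm)
    refine ⟨deriv fun ρ => h ρ * (deriv F ρ)⁻¹, ?_, ?_, ?_⟩
    · convert hw.2.2 using 1
      push_cast
      ring
    · exact (tsupport_deriv_subset (𝕜 := ℝ)).trans (tsupport_mul_subset_left.trans hsupp)
    · rw [heq, integral_exp_mul_eq hlam hgc hgδ hsupp
        (hF.differentiableOn (by exact_mod_cast M.succ_ne_zero))
        (fun ρ hρ => norm_pos_iff.1 ((mul_pos hc (pow_pos hρ.1 _)).trans_le (hb ρ hρ)))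
        hh.continuousOn hw.1 hw.2.2.continuousOn, pow_succ, mul_assoc]


/-- Non-stationary phase estimate for the piece `I₂`.
With `l = [N/γ] + 1`, if `F` is `C^{lγ+1}` on `(0,δ)` with `Im F ≥ 0`,
`|F′(ρ)| ≥ c ρ^{γ-1}` and `|F^{(m)}(ρ)| ≤ C_m ρ^{1-m} |F′(ρ)|` for
`2 ≤ m ≤ lγ`, and if `g ∈ C^l` has compact support contained in
`{ρ : (1/2)λ^{-1/γ} ≤ ρ < δ}` with `|g^{(r)}(ρ)| ≤ A ρ^{N-1-r}` for `0 ≤ r ≤ l`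
on its support, then `|∫_0^∞ e^{iλF(ρ)} g(ρ) dρ| ≤ C λ^{-N/γ}` for all `λ ≥ 1`,
with `C` depending only on `N`, `γ`, `c`, the `C_m`, and `A`. -/
theorem stmt_10 (N γ : ℕ) (hN : 1 ≤ N) (hγ : 2 ≤ γ)
    (c A : ℝ) (hc : 0 < c) (hA : 0 < A) (Cm : ℕ → ℝ) (hCm : ∀ m, 0 < Cm m) :
    ∃ C > 0, ∀ δ : ℝ, 0 < δ → ∀ (F g : ℝ → ℂ) (lam : ℝ), 1 ≤ lam →
      ContDiffOn ℝ (((N / γ + 1) * γ + 1 : ℕ) : ℕ∞) F (Set.Ioo 0 δ) →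
      (∀ ρ ∈ Set.Ioo (0:ℝ) δ, 0 ≤ (F ρ).im) →
      (∀ ρ ∈ Set.Ioo (0:ℝ) δ, c * ρ ^ (γ - 1) ≤ ‖deriv F ρ‖) →
      (∀ m : ℕ, 2 ≤ m → m ≤ (N / γ + 1) * γ → ∀ ρ ∈ Set.Ioo (0:ℝ) δ,
        ‖iteratedDeriv m F ρ‖ ≤ Cm m * ρ ^ (1 - (m : ℤ)) * ‖deriv F ρ‖) →
      ContDiff ℝ ((N / γ + 1 : ℕ) : ℕ∞) g →
      HasCompactSupport g →
      tsupport g ⊆ Set.Ico (2⁻¹ * lam ^ (-(1:ℝ)/(γ:ℝ))) δ →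
      (∀ r : ℕ, r ≤ N / γ + 1 → ∀ ρ ∈ tsupport g,
        ‖iteratedDeriv r g ρ‖ ≤ A * ρ ^ ((N : ℤ) - 1 - (r : ℤ))) →
      ‖∫ ρ in Set.Ioi (0:ℝ), Complex.exp (Complex.I * lam * F ρ) * g ρ‖ ≤
        C * lam ^ (-(N:ℝ)/(γ:ℝ)) := by
  set l := N / γ + 1 with hl
  have hγ0 : 0 < γ := by omega
  have hNl : N < l * γ := by
    rw [hl, mul_comm]; exact Nat.lt_mul_div_succ N hγ0
  have hlM : l + 1 ≤ l * γ := by nlinarith [Nat.le_add_left 1 (N / γ)]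
  obtain ⟨K, hK, hmain⟩ := exists_integral_exp_mul_eq_pow_mul (l * γ) γ l l 0 ((N : ℤ) - 1) c A hc
    hγ0 hA.le Cm hCm hlM (zero_add l)
  obtain ⟨d, hd⟩ : ∃ d : ℕ, l * γ = N + d + 1 := ⟨l * γ - N - 1, by omega⟩
  refine ⟨K * 2 ^ (d + 1) + 1, by positivity, fun δ _ F g lam hlam hF hIm hF1 hFm hg hgc hgs hgb =>
    ?_⟩
  have hlam0 : 0 < lam := one_pos.trans_le hlam
  set a : ℝ := 2⁻¹ * lam ^ (-(1:ℝ)/(γ:ℝ)) with ha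
  have ha0 : 0 < a := by positivity
  have hgδ : tsupport g ⊆ Ioo 0 δ := hgs.trans fun x hx => ⟨ha0.trans_le hx.1, hx.2⟩
  have hgS : SymbolBound δ l A ((N : ℤ) - 1) g := by
    simpa using symbolBound_iteratedDeriv (δ := δ) (A := A) (p := (N : ℤ) - 1) hg
      (fun r hr ρ hρ => by
        by_cases hρg : ρ ∈ tsupport g
        · exact hgb r hr ρ hρg
        · rw [iteratedDeriv_eq_zero_of_notMem_tsupport hρg, norm_zero]
          exact mul_nonneg hA.le (zpow_nonneg hρ.1.le _)) l 0 le_rfl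
  obtain ⟨h, hh, hsupp, heq⟩ := hmain δ F g lam hlam0.ne' hF hF1 hFm hgS hgc hgδ
  have hzero {u : ℝ → ℂ} (hu : tsupport u ⊆ tsupport g) {ρ : ℝ} (hρ : ρ ∉ tsupport g) :
      u ρ = 0 := image_eq_zero_of_notMem_tsupport fun h => hρ (hu h)
  have hIoi : ∫ ρ in Ioi (0:ℝ), Complex.exp (Complex.I * lam * F ρ) * g ρ =
      ∫ ρ, Complex.exp (Complex.I * lam * F ρ) * g ρ :=
    setIntegral_eq_integral_of_forall_compl_eq_zero fun ρ hρ => by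
      rw [hzero subset_rfl fun h => hρ (hgδ h).1, mul_zero]
  have hIci : ∫ ρ, Complex.exp (Complex.I * lam * F ρ) * h ρ =
      ∫ ρ in Ioi a, Complex.exp (Complex.I * lam * F ρ) * h ρ := by
    rw [← integral_Ici_eq_integral_Ioi]
    exact (setIntegral_eq_integral_of_forall_compl_eq_zero fun ρ hρ => by
      rw [hzero hsupp fun h => hρ (hgs h).1, mul_zero]).symm
  have hs : (-((d : ℝ) + 2)) < -1 := by linarith [d.cast_nonneg (α := ℝ)]
  have hnorm : ‖∫ ρ in Ioi a, Complex.exp (Complex.I * lam * F ρ) * h ρ‖ ≤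
      ∫ ρ in Ioi a, K * ρ ^ (-((d : ℝ) + 2)) := by
    refine norm_integral_le_of_norm_le ((integrableOn_Ioi_rpow_of_lt hs ha0).const_mul K)
      ((ae_restrict_mem measurableSet_Ioi).mono fun ρ hρ => ?_)
    have hρ0 : 0 < ρ := ha0.trans hρ
    by_cases hρg : ρ ∈ tsupport g
    · have hρδ := hgδ hρg
      have he : ‖Complex.exp (Complex.I * lam * F ρ)‖ ≤ 1 := by
        rw [Complex.norm_exp, Real.exp_le_one_iff]
        simpa using mul_nonneg hlam0.le (hIm ρ hρδ)
      rw [norm_mul]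
      refine (mul_le_of_le_one_left (norm_nonneg _) he).trans ((hh.norm_le ρ hρδ).trans_eq ?_)
      rw [← Real.rpow_intCast]
      congr 2
      have hdR : (l : ℝ) * γ = N + d + 1 := by exact_mod_cast hd
      push_cast
      linarith
    · rw [hzero hsupp hρg, mul_zero, norm_zero]
      positivity
  have hint : ∫ ρ in Ioi a, K * ρ ^ (-((d : ℝ) + 2)) ≤ K * a ^ (-((d : ℝ) + 1)) := by
    rw [integral_const_mul, integral_Ioi_rpow_of_lt hs ha0]
    refine mul_le_mul_of_nonneg_left ?_ hK
    rw [show -((d : ℝ) + 2) + 1 = -((d : ℝ) + 1) by ring, neg_div_neg_eq]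
    exact div_le_self (by positivity) (by linarith [d.cast_nonneg (α := ℝ)])
  have hpow : (lam ^ l)⁻¹ * a ^ (-((d : ℝ) + 1)) =
      2 ^ (d + 1) * lam ^ (-(N:ℝ)/(γ:ℝ)) := by
    have hγR : (γ : ℝ) ≠ 0 := by exact_mod_cast hγ0.ne'
    have hdR : (l : ℝ) * γ = N + d + 1 := by exact_mod_cast hd
    rw [ha, Real.mul_rpow (by positivity) (by positivity), ← Real.rpow_mul hlam0.le,
      Real.inv_rpow zero_le_two, Real.rpow_neg zero_le_two, inv_inv,
      ← Real.rpow_natCast lam l, ← Real.rpow_neg hlam0.le, mul_left_comm,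
      ← Real.rpow_add hlam0, ← Real.rpow_natCast 2 (d + 1)]
    congr 2
    · push_cast; rfl
    · field_simp
      linarith
  rw [hIoi, heq, norm_mul, norm_pow, norm_div, Complex.norm_I, Complex.norm_real,
    Real.norm_of_nonneg hlam0.le, one_div, inv_pow, hIci]
  calc (lam ^ l)⁻¹ * ‖∫ ρ in Ioi a, Complex.exp (Complex.I * lam * F ρ) * h ρ‖
      ≤ (lam ^ l)⁻¹ * (K * a ^ (-((d : ℝ) + 1))) :=
        mul_le_mul_of_nonneg_left (hnorm.trans hint) (by positivity)
    _ = K * 2 ^ (d + 1) * lam ^ (-(N:ℝ)/(γ:ℝ)) := by rw [mul_left_comm, hpow]; ring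
    _ ≤ _ := mul_le_mul_of_nonneg_right (le_add_of_nonneg_right zero_le_one) (by positivity)
end

section
/- Let γ ≥ 2 be an integer and let F(ρ,μ) be complex valued and smooth (C^∞) in ρ on [0,δ), satisfying conditions (F1)–(F3), and satisfying condition (F4) for ALL orders: for every m ∈ ℕ there is M_m > 0 with |∂_ρ^m F(ρ,μ)| ≤ M_m uniformly in 0 < ρ < δ and μ. Then, if δ > 0 is sufficiently small, there exist constants C > 0 and, for every m ∈ ℕ, C_m > 0, such that |∂_ρ F(ρ,μ)| ≥ C ρ^{γ-1} and |∂_ρ^m F(ρ,μ)| ≤ C_m ρ^{1-m} |∂_ρ F(ρ,μ)| hold for all 0 < ρ < δ, all parameters μ, and all m ∈ ℕ; moreover, for m > γ one has the stronger bound |∂_ρ^m F(ρ,μ)| ≤ C_m ρ^{2-m} |∂_ρ F(ρ,μ)|. -/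
open Set Finset

/-- On polynomials of degree `< n`, the sum of the norms of the coefficients is controlled by the
supremum over `(0, 1]`. -/
theorem exists_sum_norm_coeff_le (n : ℕ) :
    ∃ K : ℝ, 0 < K ∧ ∀ (b : ℕ → ℂ) (B : ℝ), 0 ≤ B →
      (∀ t : ℝ, 0 < t → t ≤ 1 → ‖∑ i ∈ range n, b i * (t : ℂ) ^ i‖ ≤ B) →
      ∑ i ∈ range n, ‖b i‖ ≤ K * B := by
  let t : Fin n → ℝ := fun k => 1 / ((k : ℝ) + 1)
  let V : Matrix (Fin n) (Fin n) ℂ := Matrix.vandermonde fun k => (t k : ℂ)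
  have hV : V.det ≠ 0 := by
    rw [Matrix.det_vandermonde_ne_zero_iff]
    intro k l hkl
    have : (k : ℝ) = l := by simpa [t] using hkl
    exact Fin.ext (by exact_mod_cast this)
  have hker : LinearMap.ker V.mulVecLin = ⊥ := by
    rw [LinearMap.ker_eq_bot]
    exact Matrix.mulVec_injective_of_isUnit
      ((Matrix.isUnit_iff_isUnit_det _).2 (isUnit_iff_ne_zero.2 hV))
  obtain ⟨K, hK, hanti⟩ := V.mulVecLin.exists_antilipschitzWith hker
  refine ⟨n * K + 1, by positivity, fun b B hB hb => ?_⟩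
  let c : Fin n → ℂ := fun i => b i
  have hc : ‖c‖ ≤ K * ‖V.mulVecLin c‖ := by
    simpa using hanti.le_mul_dist c 0
  have hVc : ‖V.mulVecLin c‖ ≤ B := by
    refine (pi_norm_le_iff_of_nonneg hB).2 fun k => ?_
    have hk := hb (t k) (by positivity)
      (by rw [div_le_one (by positivity)]; linarith [(k : ℕ).cast_nonneg (α := ℝ)])
    rw [← Fin.sum_univ_eq_sum_range (fun i => b i * ((t k : ℝ) : ℂ) ^ i)] at hk
    simpa [V, c, Matrix.mulVec, dotProduct, mul_comm] using hk
  calc ∑ i ∈ range n, ‖b i‖ = ∑ i : Fin n, ‖c i‖ :=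
        (Fin.sum_univ_eq_sum_range (fun i => ‖b i‖) n).symm
    _ ≤ ∑ _i : Fin n, ‖c‖ := sum_le_sum fun i _ => norm_le_pi_norm c i
    _ = n * ‖c‖ := by simp
    _ ≤ n * (K * B) := by gcongr; exact hc.trans (by gcongr)
    _ ≤ (n * K + 1) * B := by nlinarith

/-- Taylor's inequality at `0` for a sequence of successive derivatives on `[0, δ)`. -/
theorem norm_sub_taylor_sum_le {δ A : ℝ} {n : ℕ} {g : ℕ → ℝ → ℂ}
    (hg : ∀ k, ∀ x ∈ Ico 0 δ, HasDerivWithinAt (g k) (g (k + 1) x) (Ico 0 δ) x)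
    {k : ℕ} (hA : ∀ x ∈ Ico 0 δ, ‖g (k + n) x‖ ≤ A) {x : ℝ} (hx : x ∈ Ico 0 δ) :
    ‖g k x - ∑ i ∈ range n, g (k + i) 0 / (i.factorial : ℂ) * (x : ℂ) ^ i‖ ≤ A * x ^ n := by
  induction n generalizing k x with
  | zero => simpa using hA x hx
  | succ n ih =>
    have hsub : Icc 0 x ⊆ Ico 0 δ := fun y hy => ⟨hy.1, hy.2.trans_lt hx.2⟩
    have hA0 : 0 ≤ A := (norm_nonneg _).trans (hA x hx)
    have hA' : ∀ y ∈ Ico 0 δ, ‖g (k + 1 + n) y‖ ≤ A := by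
      intro y hy
      rw [add_right_comm]
      exact hA y hy
    have hderiv : ∀ y ∈ Icc 0 x, HasDerivWithinAt
        (fun y : ℝ => g k y -
          ∑ i ∈ range (n + 1), g (k + i) 0 / (i.factorial : ℂ) * (y : ℂ) ^ i)
        (g (k + 1) y - ∑ i ∈ range n, g (k + 1 + i) 0 / (i.factorial : ℂ) * (y : ℂ) ^ i)
        (Icc 0 x) y := by
      intro y hy
      refine ((hg k y (hsub hy)).mono hsub).sub ?_
      simp only [sum_range_succ', pow_zero, mul_one]
      refine HasDerivWithinAt.add_const _ (HasDerivWithinAt.fun_sum fun i _ => ?_)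
      have h := ((hasDerivAt_pow (i + 1) (y : ℂ)).comp_ofReal.const_mul
        (g (k + (i + 1)) 0 / ((i + 1).factorial : ℂ))).hasDerivWithinAt (s := Icc 0 x)
      convert h using 1
      have : ((i : ℂ) + 1) ≠ 0 := by exact_mod_cast i.succ_ne_zero
      have : (i.factorial : ℂ) ≠ 0 := by exact_mod_cast i.factorial_ne_zero
      rw [Nat.factorial_succ, add_right_comm k 1 i, ← add_assoc]
      push_cast
      field_simp
    have hbound : ∀ y ∈ Icc 0 x, ‖g (k + 1) y -
        ∑ i ∈ range n, g (k + 1 + i) 0 / (i.factorial : ℂ) * (y : ℂ) ^ i‖ ≤ A * x ^ n := by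
      intro y hy
      refine (ih hA' (hsub hy)).trans ?_
      have := hy.1
      have := hy.2
      gcongr
    have h := (convex_Icc 0 x).norm_image_sub_le_of_norm_hasDerivWithin_le hderiv hbound
      (left_mem_Icc.2 hx.1) (right_mem_Icc.2 hx.1)
    simpa [sum_range_succ', abs_of_nonneg hx.1, pow_succ, mul_assoc] using h

/-- If `‖g 1‖` is monotone and the Taylor coefficients of `g 1` at `0` up to degree `γ - 1` are
bounded below, then `‖g 1‖` dominates the terms of its Taylor polynomial of degree `γ - 1`. -/
theorem sum_taylor_coeff_le_of_monotoneOn {δ A K C₀ : ℝ} {γ : ℕ} (hγ : 1 ≤ γ)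
    {g : ℕ → ℝ → ℂ} (hK : 0 < K) (hA : 0 ≤ A)
    (hpoly : ∀ (b : ℕ → ℂ) (B : ℝ), 0 ≤ B →
      (∀ t : ℝ, 0 < t → t ≤ 1 → ‖∑ i ∈ range γ, b i * (t : ℂ) ^ i‖ ≤ B) →
      ∑ i ∈ range γ, ‖b i‖ ≤ K * B)
    (hδ : δ ≤ 1) (hδA : 2 * K * A * δ ≤ C₀)
    (hC₀ : C₀ ≤ ∑ i ∈ range γ, ‖g (1 + i) 0 / (i.factorial : ℂ)‖)
    (hmono : MonotoneOn (fun x => ‖g 1 x‖) (Ioo 0 δ))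
    (htaylor : ∀ x ∈ Ico 0 δ,
      ‖g 1 x - ∑ i ∈ range γ, g (1 + i) 0 / (i.factorial : ℂ) * (x : ℂ) ^ i‖ ≤ A * x ^ γ)
    {x : ℝ} (hx : x ∈ Ioo 0 δ) :
    C₀ * x ^ (γ - 1) ≤ ∑ i ∈ range γ, ‖g (1 + i) 0 / (i.factorial : ℂ)‖ * x ^ i ∧
    ∑ i ∈ range γ, ‖g (1 + i) 0 / (i.factorial : ℂ)‖ * x ^ i ≤ 2 * K * ‖g 1 x‖ := by
  obtain ⟨hx0, hxδ⟩ := hx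
  have hlow : C₀ * x ^ (γ - 1) ≤
      ∑ i ∈ range γ, ‖g (1 + i) 0 / (i.factorial : ℂ)‖ * x ^ i := by
    calc C₀ * x ^ (γ - 1)
        ≤ (∑ i ∈ range γ, ‖g (1 + i) 0 / (i.factorial : ℂ)‖) * x ^ (γ - 1) := by gcongr
      _ = ∑ i ∈ range γ, ‖g (1 + i) 0 / (i.factorial : ℂ)‖ * x ^ (γ - 1) := sum_mul ..
      _ ≤ _ := by
        refine sum_le_sum fun i hi => ?_
        have : i ≤ γ - 1 := by have := mem_range.1 hi; omega
        exact mul_le_mul_of_nonneg_left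
          (pow_le_pow_of_le_one hx0.le (hxδ.le.trans hδ) this) (norm_nonneg _)
  refine ⟨hlow, ?_⟩
  have hup := hpoly (fun i => g (1 + i) 0 / (i.factorial : ℂ) * (x : ℂ) ^ i)
    (‖g 1 x‖ + A * x ^ γ) (by positivity) fun t ht ht1 => by
      have htx : t * x ≤ x := mul_le_of_le_one_left hx0.le ht1
      have htx0 : 0 < t * x := mul_pos ht hx0
      have h1 := htaylor (t * x) ⟨htx0.le, htx.trans_lt hxδ⟩
      have h2 : ‖g 1 (t * x)‖ ≤ ‖g 1 x‖ :=
        hmono ⟨htx0, htx.trans_lt hxδ⟩ ⟨hx0, hxδ⟩ htx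
      have h3 : A * (t * x) ^ γ ≤ A * x ^ γ := by gcongr
      have h4 : ∑ i ∈ range γ, g (1 + i) 0 / (i.factorial : ℂ) * (x : ℂ) ^ i * (t : ℂ) ^ i =
          ∑ i ∈ range γ, g (1 + i) 0 / (i.factorial : ℂ) * ((t * x : ℝ) : ℂ) ^ i := by
        refine sum_congr rfl fun i _ => ?_
        push_cast
        ring
      rw [h4]
      have h5 := norm_sub_norm_le (∑ i ∈ range γ, g (1 + i) 0 / (i.factorial : ℂ) *
        ((t * x : ℝ) : ℂ) ^ i) (g 1 (t * x))
      rw [norm_sub_rev] at h5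
      linarith
  simp only [norm_mul, norm_pow, Complex.norm_real, Real.norm_of_nonneg hx0.le] at hup
  have hrem : 2 * K * (A * x ^ γ) ≤ C₀ * x ^ (γ - 1) := by
    obtain ⟨n, rfl⟩ : ∃ n, γ = n + 1 := ⟨γ - 1, by omega⟩
    have : 2 * K * A * x ≤ C₀ := le_trans (by gcongr) hδA
    calc 2 * K * (A * x ^ (n + 1)) = 2 * K * A * x * x ^ n := by ring
      _ ≤ _ := by rw [Nat.add_sub_cancel]; gcongr
  linarith

/-- A derivative scaled by its order is bounded by the Taylor coefficients and the remainder. -/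
theorem norm_mul_pow_le_sum_taylor_coeff {A x : ℝ} {k n : ℕ} {g : ℕ → ℝ → ℂ} (hx : 0 ≤ x)
    (htaylor : ‖g (1 + k) x -
      ∑ i ∈ range n, g (1 + k + i) 0 / (i.factorial : ℂ) * (x : ℂ) ^ i‖ ≤ A * x ^ n) :
    ‖g (1 + k) x‖ * x ^ k ≤ (k + n).factorial *
      ∑ i ∈ range (k + n), ‖g (1 + i) 0 / (i.factorial : ℂ)‖ * x ^ i + A * x ^ (k + n) := by
  have h1 : ‖g (1 + k) x‖ ≤
      ∑ i ∈ range n, ‖g (1 + k + i) 0 / (i.factorial : ℂ)‖ * x ^ i + A * x ^ n := by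
    have h := norm_sub_norm_le (g (1 + k) x)
      (∑ i ∈ range n, g (1 + k + i) 0 / (i.factorial : ℂ) * (x : ℂ) ^ i)
    have h' := norm_sum_le (range n)
      fun i => g (1 + k + i) 0 / (i.factorial : ℂ) * (x : ℂ) ^ i
    simp only [norm_mul, norm_pow, Complex.norm_real, Real.norm_of_nonneg hx] at h'
    linarith
  calc ‖g (1 + k) x‖ * x ^ k
      ≤ (∑ i ∈ range n, ‖g (1 + k + i) 0 / (i.factorial : ℂ)‖ * x ^ i + A * x ^ n) * x ^ k := by
        gcongr
    _ = ∑ i ∈ range n, ‖g (1 + k + i) 0 / (i.factorial : ℂ)‖ * x ^ (k + i) +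
          A * x ^ (k + n) := by
        rw [add_mul, sum_mul]
        congr 1
        · exact sum_congr rfl fun i _ => by ring
        · ring
    _ ≤ _ := by
      gcongr
      rw [mul_sum, sum_range_add]
      refine le_add_of_nonneg_of_le (sum_nonneg fun i _ => by positivity)
        (sum_le_sum fun i hi => ?_)
      rw [← mul_assoc]
      gcongr
      rw [norm_div, norm_div, Complex.norm_natCast, Complex.norm_natCast, add_assoc,
        mul_div_assoc', le_div_iff₀ (by positivity), div_mul_eq_mul_div,
        div_le_iff₀ (by positivity), mul_comm _ ‖_‖, mul_assoc]
      gcongr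
      have h2 : (k + i).factorial ≤ (k + n).factorial :=
        Nat.factorial_le (by have := mem_range.1 hi; omega)
      have h3 : 1 ≤ i.factorial := Nat.factorial_pos i
      exact_mod_cast h2.trans (Nat.le_mul_of_pos_right _ h3)

theorem norm_le_mul_norm_deriv_of_monotoneOn {δ : ℝ} {f f' : ℝ → ℂ}
    (hf : ∀ x ∈ Ico 0 δ, HasDerivWithinAt f (f' x) (Ico 0 δ) x) (h0 : f 0 = 0)
    (h0' : f' 0 = 0) (hmono : MonotoneOn (fun x => ‖f' x‖) (Ioo 0 δ)) {x : ℝ}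
    (hx : x ∈ Ioo 0 δ) : ‖f x‖ ≤ x * ‖f' x‖ := by
  have hsub : Icc 0 x ⊆ Ico 0 δ := fun y hy => ⟨hy.1, hy.2.trans_lt hx.2⟩
  have hbound : ∀ y ∈ Icc 0 x, ‖f' y‖ ≤ ‖f' x‖ := by
    intro y hy
    rcases hy.1.eq_or_lt with rfl | hy0
    · simp [h0']
    · exact hmono ⟨hy0, hy.2.trans_lt hx.2⟩ hx hy.2
  have h := (convex_Icc 0 x).norm_image_sub_le_of_norm_hasDerivWithin_le
    (fun y hy => (hf y (hsub hy)).mono hsub) hbound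
    (left_mem_Icc.2 hx.1.le) (right_mem_Icc.2 hx.1.le)
  simpa [h0, abs_of_pos hx.1, mul_comm] using h

theorem ContDiffOn.hasDerivWithinAt_iteratedDerivWithin {f : ℝ → ℂ} {s : Set ℝ}
    (hf : ContDiffOn ℝ (⊤ : ℕ∞) f s) (hs : UniqueDiffOn ℝ s) (k : ℕ) {x : ℝ} (hx : x ∈ s) :
    HasDerivWithinAt (iteratedDerivWithin k f s) (iteratedDerivWithin (k + 1) f s x) s x := by
  rw [iteratedDerivWithin_succ]
  exact (hf.differentiableOn_iteratedDerivWithin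
    (by exact_mod_cast WithTop.coe_lt_top k) hs x hx).hasDerivWithinAt

/-- A bound on `(0, δ)` extends to `[0, δ)` by continuity. -/
theorem norm_le_on_Ico_of_norm_le_on_Ioo {δ A : ℝ} {f : ℝ → ℂ}
    (hf : ContinuousOn f (Ico 0 δ)) (hA : ∀ x ∈ Ioo 0 δ, ‖f x‖ ≤ A) {x : ℝ}
    (hx : x ∈ Ico 0 δ) : ‖f x‖ ≤ A := by
  have hδ : 0 < δ := hx.1.trans_lt hx.2
  have hcl : x ∈ closure (Ioo 0 δ) := by
    rw [closure_Ioo hδ.ne]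
    exact Ico_subset_Icc_self hx
  exact ((hf x hx).mono Ioo_subset_Ico_self).norm.closure_le hcl continuousWithinAt_const hA


/-- Smooth version. Let `γ ≥ 2` and let `F(ρ,μ)` be complex
valued and smooth in `ρ` on `[0,δ)`, satisfying (F1)–(F3) and (F4) for all
orders `m ∈ ℕ`. Then, for `δ > 0` sufficiently small, there are constants
`C > 0` and `C_m > 0` (for each `m ∈ ℕ`) such that
`|∂_ρ F(ρ,μ)| ≥ C ρ^{γ-1}` and `|∂_ρ^m F(ρ,μ)| ≤ C_m ρ^{1-m} |∂_ρ F(ρ,μ)|`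
for all `0 < ρ < δ`, all `μ` and all `m ∈ ℕ`; moreover, for `m > γ` one has
the stronger bound `|∂_ρ^m F(ρ,μ)| ≤ C_m ρ^{2-m} |∂_ρ F(ρ,μ)|`. -/
theorem stmt_13 (γ : ℕ) (hγ : 2 ≤ γ) (P : Type*) [Nonempty P]
    (C₀ : ℝ) (hC₀ : 0 < C₀) (M : ℕ → ℝ) :
    ∃ δ₀ > 0, ∀ δ : ℝ, 0 < δ → δ ≤ δ₀ →
      ∀ F : P → ℝ → ℂ,
        -- `F(·,μ)` is smooth on `[0,δ)`
        (∀ μ, ContDiffOn ℝ (⊤ : ℕ∞) (F μ) (Set.Ico 0 δ)) →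
        -- (F1): `a₀(μ) = a₁(μ) = 0`
        (∀ μ, iteratedDerivWithin 0 (F μ) (Set.Ico 0 δ) 0 = 0 ∧
              iteratedDerivWithin 1 (F μ) (Set.Ico 0 δ) 0 = 0) →
        -- (F2): `∑_{j=2}^γ |a_j(μ)| ≥ C₀`
        (∀ μ, C₀ ≤ ∑ j ∈ Finset.Icc 2 γ,
              ‖iteratedDerivWithin j (F μ) (Set.Ico 0 δ) 0 / (j.factorial : ℂ)‖) →
        -- (F3): `|∂_ρ F(ρ,μ)|` is increasing in `ρ` on `(0,δ)`
        (∀ μ, MonotoneOn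
              (fun ρ => ‖iteratedDerivWithin 1 (F μ) (Set.Ico 0 δ) ρ‖)
              (Set.Ioo 0 δ)) →
        -- (F4) for all orders: `|∂_ρ^m F(ρ,μ)| ≤ M_m` on `(0,δ)` for all `m ∈ ℕ`
        (∀ m : ℕ, ∀ μ, ∀ ρ ∈ Set.Ioo (0:ℝ) δ,
              ‖iteratedDerivWithin m (F μ) (Set.Ico 0 δ) ρ‖ ≤ M m) →
        (∃ C > 0, ∀ μ, ∀ ρ ∈ Set.Ioo (0:ℝ) δ,
          C * ρ ^ (γ - 1) ≤ ‖iteratedDerivWithin 1 (F μ) (Set.Ico 0 δ) ρ‖) ∧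
        (∀ m : ℕ, ∃ C > 0, ∀ μ, ∀ ρ ∈ Set.Ioo (0:ℝ) δ,
          ‖iteratedDerivWithin m (F μ) (Set.Ico 0 δ) ρ‖ ≤
            C * ρ ^ (1 - (m : ℤ)) *
              ‖iteratedDerivWithin 1 (F μ) (Set.Ico 0 δ) ρ‖ ∧
          (γ < m →
            ‖iteratedDerivWithin m (F μ) (Set.Ico 0 δ) ρ‖ ≤
              C * ρ ^ (2 - (m : ℤ)) *
                ‖iteratedDerivWithin 1 (F μ) (Set.Ico 0 δ) ρ‖)) := by
  obtain ⟨K, hK, hpoly⟩ := exists_sum_norm_coeff_le γ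
  set A : ℝ := |M (γ + 1)| + 1 with hAdef
  have hA : 0 < A := by positivity
  refine ⟨min 1 (C₀ / (2 * K * A)), by positivity, fun δ hδ hδ₀ F hF h1 h2 h3 h4 => ?_⟩
  have hδ1 : δ ≤ 1 := hδ₀.trans (min_le_left _ _)
  have hδA : 2 * K * A * δ ≤ C₀ := by
    rw [mul_comm]
    exact (le_div_iff₀ (by positivity)).1 (hδ₀.trans (min_le_right _ _))
  have hderiv : ∀ μ k, ∀ x ∈ Ico 0 δ, HasDerivWithinAt (iteratedDerivWithin k (F μ) (Ico 0 δ))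
      (iteratedDerivWithin (k + 1) (F μ) (Ico 0 δ) x) (Ico 0 δ) x := fun μ k x hx =>
    (hF μ).hasDerivWithinAt_iteratedDerivWithin (uniqueDiffOn_Ico 0 δ) k hx
  have htop : ∀ μ, ∀ x ∈ Ico 0 δ,
      ‖iteratedDerivWithin (γ + 1) (F μ) (Ico 0 δ) x‖ ≤ A := fun μ x hx =>
    norm_le_on_Ico_of_norm_le_on_Ioo (fun y hy => (hderiv μ (γ + 1) y hy).continuousWithinAt)
      (fun y hy => (h4 (γ + 1) μ y hy).trans
        ((le_abs_self _).trans (le_add_of_nonneg_right zero_le_one))) hx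
  have htaylor : ∀ μ k n, k + n = γ → ∀ x ∈ Ico 0 δ,
      ‖iteratedDerivWithin (1 + k) (F μ) (Ico 0 δ) x - ∑ i ∈ range n,
        iteratedDerivWithin (1 + k + i) (F μ) (Ico 0 δ) 0 / (i.factorial : ℂ) * (x : ℂ) ^ i‖
        ≤ A * x ^ n := fun μ k n hkn x hx =>
    norm_sub_taylor_sum_le (g := fun k => iteratedDerivWithin k (F μ) (Ico 0 δ)) (hderiv μ)
      (fun y hy => by rw [show 1 + k + n = γ + 1 by omega]; exact htop μ y hy) hx
  have hcoeff : ∀ μ, C₀ ≤ ∑ i ∈ range γ,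
      ‖iteratedDerivWithin (1 + i) (F μ) (Ico 0 δ) 0 / (i.factorial : ℂ)‖ := by
    intro μ
    refine (h2 μ).trans ?_
    rw [← Finset.Ico_add_one_right_eq_Icc, sum_Ico_eq_sum_range]
    obtain ⟨n, rfl⟩ : ∃ n, γ = n + 1 := ⟨γ - 1, by omega⟩
    rw [sum_range_succ', show n + 1 + 1 - 2 = n by omega]
    refine le_add_of_le_of_nonneg (sum_le_sum fun i _ => ?_) (norm_nonneg _)
    rw [show 1 + (i + 1) = 2 + i by ring, norm_div, norm_div, Complex.norm_natCast,
      Complex.norm_natCast]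
    gcongr _ / (Nat.factorial ?_ : ℝ)
    omega
  have hmain : ∀ μ, ∀ x ∈ Ioo 0 δ, _ := fun μ x hx =>
    sum_taylor_coeff_le_of_monotoneOn (g := fun k => iteratedDerivWithin k (F μ) (Ico 0 δ))
      (by omega : 1 ≤ γ) hK hA.le hpoly hδ1 hδA (hcoeff μ) (h3 μ)
      (htaylor μ 0 γ (zero_add γ)) hx
  have hlow : ∀ μ, ∀ x ∈ Ioo 0 δ, C₀ / (2 * K) * x ^ (γ - 1) ≤
      ‖iteratedDerivWithin 1 (F μ) (Ico 0 δ) x‖ := by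
    intro μ x hx
    rw [div_mul_eq_mul_div, div_le_iff₀ (by positivity), mul_comm ‖_‖]
    exact (hmain μ x hx).1.trans (hmain μ x hx).2
  refine ⟨⟨C₀ / (2 * K), by positivity, hlow⟩, fun m => ?_⟩
  rcases Nat.lt_or_ge γ m with hm | hm
  · have hstrong : ∀ μ, ∀ x ∈ Ioo 0 δ, ‖iteratedDerivWithin m (F μ) (Ico 0 δ) x‖ ≤
        (|M m| + 1) * (2 * K / C₀) * x ^ (2 - (m : ℤ)) *
          ‖iteratedDerivWithin 1 (F μ) (Ico 0 δ) x‖ := by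
      intro μ x hx
      have hx0 : 0 < x := hx.1
      have hpow : 1 ≤ x ^ (2 - (m : ℤ)) * x ^ (γ - 1) := by
        rw [← zpow_natCast, ← zpow_add₀ hx0.ne']
        exact one_le_zpow_of_nonpos₀ hx0 (hx.2.le.trans hδ1) (by omega)
      calc ‖iteratedDerivWithin m (F μ) (Ico 0 δ) x‖ ≤ |M m| + 1 :=
            (h4 m μ x hx).trans ((le_abs_self _).trans (le_add_of_nonneg_right zero_le_one))
        _ ≤ (|M m| + 1) * (x ^ (2 - (m : ℤ)) * x ^ (γ - 1)) :=
            le_mul_of_one_le_right (by positivity) hpow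
        _ = (|M m| + 1) * (2 * K / C₀) * x ^ (2 - (m : ℤ)) *
            (C₀ / (2 * K) * x ^ (γ - 1)) := by field_simp
        _ ≤ _ := by
            gcongr
            exact hlow μ x hx
    refine ⟨(|M m| + 1) * (2 * K / C₀), by positivity, fun μ x hx =>
      ⟨(hstrong μ x hx).trans ?_, fun _ => hstrong μ x hx⟩⟩
    have hx0 : 0 < x := hx.1
    gcongr ?_ * ?_ * ?_
    exact zpow_le_zpow_right_of_le_one₀ hx0 (hx.2.le.trans hδ1) (by omega)
  rcases Nat.eq_zero_or_pos m with rfl | hm0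
  · refine ⟨1, one_pos, fun μ x hx => ⟨?_, fun h => absurd h (by omega)⟩⟩
    simpa using norm_le_mul_norm_deriv_of_monotoneOn (hderiv μ 0) (h1 μ).1 (h1 μ).2 (h3 μ) hx
  obtain ⟨k, rfl⟩ : ∃ k, m = 1 + k := ⟨m - 1, by omega⟩
  refine ⟨(γ.factorial + A / C₀) * (2 * K), by positivity,
    fun μ x hx => ⟨?_, fun h => absurd h (by omega)⟩⟩
  have hx0 : 0 < x := hx.1
  have hkn : k + (γ - k) = γ := by omega
  have hscaled := norm_mul_pow_le_sum_taylor_coeff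
    (g := fun k => iteratedDerivWithin k (F μ) (Ico 0 δ)) hx0.le
    (htaylor μ k (γ - k) hkn x (Ioo_subset_Ico_self hx))
  rw [hkn] at hscaled
  obtain ⟨hl, hu⟩ := hmain μ x hx
  set S := ∑ i ∈ range γ,
    ‖iteratedDerivWithin (1 + i) (F μ) (Ico 0 δ) 0 / (i.factorial : ℂ)‖ * x ^ i
  have hrem : A * x ^ γ ≤ A / C₀ * S :=
    calc A * x ^ γ ≤ A * x ^ (γ - 1) := by
          gcongr A * ?_
          exact pow_le_pow_of_le_one hx0.le (hx.2.le.trans hδ1) (Nat.sub_le γ 1)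
      _ = A / C₀ * (C₀ * x ^ (γ - 1)) := by field_simp
      _ ≤ A / C₀ * S := by gcongr
  have hfin : ‖iteratedDerivWithin (1 + k) (F μ) (Ico 0 δ) x‖ * x ^ k ≤
      (γ.factorial + A / C₀) * (2 * K) * ‖iteratedDerivWithin 1 (F μ) (Ico 0 δ) x‖ :=
    calc _ ≤ γ.factorial * S + A / C₀ * S := hscaled.trans (by gcongr)
      _ = (γ.factorial + A / C₀) * S := by ring
      _ ≤ (γ.factorial + A / C₀) * (2 * K * ‖iteratedDerivWithin 1 (F μ) (Ico 0 δ) x‖) := by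
          gcongr
      _ = _ := by ring
  rw [show (1 - ((1 + k : ℕ) : ℤ)) = -(k : ℤ) by push_cast; ring, zpow_neg, zpow_natCast,
    mul_right_comm, ← div_eq_mul_inv, le_div_iff₀ (by positivity)]
  exact hfin
end
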